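/- Let F : ℝ^n → ℝ^n be an everywhere defined real rational map whose Jacobian determinant vanishes nowhere on ℝ^n, and suppose the finite field extension ℝ(F) ⊆ ℝ(x_1, …, x_n) is Galois. Then the following are equivalent: (1) F is a bijection of ℝ^n onto ℝ^n with real analytic inverse; (2) there is an everywhere defined real rational map G : ℝ^n → ℝ^n with G ∘ F = id and F ∘ G = id; (3) F is birational, i.e., ℝ(F) = ℝ(x_1, …, x_n); (4) the Galois group of ℝ(x_1, …, x_n) over ℝ(F) is trivial. -/

import Mathlib

noncomputable section

/-- `ℝ(x₁, …, xₙ)`, the fraction field of `ℝ[x₁, …, xₙ]`. -/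
abbrev RatFuncField (n : ℕ) := FractionRing (MvPolynomial (Fin n) ℝ)

/-- `F : ℝⁿ → ℝⁿ` is an everywhere defined real rational map with components corresponding
to the rational functions `f i ∈ ℝ(x₁, …, xₙ)`. -/
def IsEverywhereDefRatMap (n : ℕ) (F : (Fin n → ℝ) → (Fin n → ℝ))
    (f : Fin n → RatFuncField n) : Prop :=
  ∀ i : Fin n, ∃ p q : MvPolynomial (Fin n) ℝ,
    (∀ x : Fin n → ℝ, MvPolynomial.eval x q ≠ 0) ∧
    f i = algebraMap (MvPolynomial (Fin n) ℝ) (RatFuncField n) p /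
      algebraMap (MvPolynomial (Fin n) ℝ) (RatFuncField n) q ∧
    ∀ x : Fin n → ℝ, F x i = MvPolynomial.eval x p / MvPolynomial.eval x q


section Part1
open scoped TensorProduct

lemma PL_field (E : Type) [CommRing E] [Algebra ℝ E] [Module.Finite ℝ E]
    [Algebra.FormallyUnramified ℝ E] :
    Nat.card (E →ₐ[ℝ] ℝ) % 2 = Module.finrank ℝ E % 2 := by
  classical
  have : IsArtinianRing E := IsArtinianRing.of_finite ℝ E
  have : IsReduced E := Algebra.FormallyUnramified.isReduced_of_field ℝ E
  let _ : ∀ I : MaximalSpectrum E, Field (E ⧸ I.asIdeal) := fun I => Ideal.Quotient.field I.asIdeal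
  have e : E ≃ₐ[ℝ] ∀ I : MaximalSpectrum E, E ⧸ I.asIdeal :=
    (IsArtinianRing.equivPi E).restrictScalars ℝ
  have : Fintype (MaximalSpectrum E) := Fintype.ofFinite _
  have h1 : Module.finrank ℝ E = ∑ I : MaximalSpectrum E, Module.finrank ℝ (E ⧸ I.asIdeal) := by
    rw [e.toLinearEquiv.finrank_eq]
    exact Module.finrank_pi_fintype ℝ
  have h2 : ∀ I : MaximalSpectrum E, Module.finrank ℝ (E ⧸ I.asIdeal) = 1 ∨
      Module.finrank ℝ (E ⧸ I.asIdeal) = 2 := by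
    intro I
    rcases Real.nonempty_algEquiv_or (E ⧸ I.asIdeal) with h | h
    · left; rw [h.some.toLinearEquiv.finrank_eq]; simp
    · right; rw [h.some.toLinearEquiv.finrank_eq]; simp
  have h3 : Nat.card (E →ₐ[ℝ] ℝ) =
      (Finset.univ.filter fun I : MaximalSpectrum E => Module.finrank ℝ (E ⧸ I.asIdeal) = 1).card := by
    have hmax : ∀ φ : E →ₐ[ℝ] ℝ, (RingHom.ker φ).IsMaximal := fun φ =>
      RingHom.ker_isMaximal_of_surjective φ (fun r => ⟨algebraMap ℝ E r, by simp⟩)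
    rw [← Fintype.card_subtype, ← Nat.card_eq_fintype_card]
    refine Nat.card_congr (Equiv.ofBijective (fun φ => ⟨⟨RingHom.ker φ, hmax φ⟩, ?_⟩) ⟨?_, ?_⟩)
    · have hs : Function.Surjective φ := fun r => ⟨algebraMap ℝ E r, by simp⟩
      have := (Ideal.quotientKerAlgEquivOfSurjective hs).toLinearEquiv.finrank_eq
      rw [Module.finrank_self] at this
      exact this
    · intro φ ψ h
      simp only [Subtype.mk.injEq, MaximalSpectrum.mk.injEq] at h
      ext x
      have : x - algebraMap ℝ E (φ x) ∈ RingHom.ker φ := by simp [RingHom.mem_ker]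
      rw [h] at this
      simp only [RingHom.mem_ker, map_sub, AlgHom.commutes, Algebra.algebraMap_self, RingHom.id_apply] at this
      linarith
    · rintro ⟨I, hI⟩
      rcases Real.nonempty_algEquiv_or (E ⧸ I.asIdeal) with h | h
      · refine ⟨h.some.toAlgHom.comp (Ideal.Quotient.mkₐ ℝ I.asIdeal), ?_⟩
        ext x
        simp [RingHom.mem_ker, Ideal.Quotient.eq_zero_iff_mem]
      · rw [h.some.toLinearEquiv.finrank_eq] at hI; simp at hI
  rw [h1, h3, Finset.sum_nat_mod, Finset.card_filter, Finset.sum_nat_mod]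
  congr 1
  apply Finset.sum_congr rfl
  intro I _
  rcases h2 I with h | h <;> simp [h]

lemma PL_free (T B : Type) [CommRing T] [CommRing B] [Algebra T B] [Module.Finite T B]
    [Module.Free T B] [Algebra.FormallyUnramified T B] [Algebra T ℝ] :
    Finite (B →ₐ[T] ℝ) ∧ Nat.card (B →ₐ[T] ℝ) % 2 = Module.finrank T B % 2 := by
  have : Nontrivial T := (algebraMap T ℝ).domain_nontrivial
  have h := PL_field (ℝ ⊗[T] B)
  rw [Module.finrank_baseChange] at h
  have e := AlgHom.liftEquiv T ℝ B ℝ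
  have : Finite (ℝ ⊗[T] B →ₐ[ℝ] ℝ) := inferInstance
  exact ⟨Finite.of_equiv _ e.symm, by rw [Nat.card_congr e, h]⟩

end Part1

section Part2
open scoped TensorProduct

lemma PL_down (T A : Type) [CommRing T] [IsDomain T] [CommRing A] [Algebra T A] (d : T) (hd : d ≠ 0)
    (ε : ℕ) (δ : Localization.Away d) (hδ : δ ≠ 0)
    (h : ∀ _ : Algebra (Localization.Away d) ℝ, algebraMap (Localization.Away d) ℝ δ ≠ 0 →
      Finite ((Localization.Away d ⊗[T] A) →ₐ[Localization.Away d] ℝ) ∧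
      Nat.card ((Localization.Away d ⊗[T] A) →ₐ[Localization.Away d] ℝ) % 2 = ε) :
    ∃ δ' : T, δ' ≠ 0 ∧ ∀ _ : Algebra T ℝ, algebraMap T ℝ δ' ≠ 0 →
      Finite (A →ₐ[T] ℝ) ∧ Nat.card (A →ₐ[T] ℝ) % 2 = ε := by
  obtain ⟨k, a, ha⟩ := IsLocalization.Away.surj d δ
  have hinj : Function.Injective (algebraMap T (Localization.Away d)) :=
    IsLocalization.injective _ (powers_le_nonZeroDivisors_of_noZeroDivisors hd)
  have : IsDomain (Localization.Away d) :=
    IsLocalization.isDomain_localization (powers_le_nonZeroDivisors_of_noZeroDivisors hd)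
  refine ⟨d * a, mul_ne_zero hd ?_, ?_⟩
  · rintro rfl
    rw [map_zero] at ha
    have := (mul_eq_zero.1 ha).resolve_left hδ
    rcases Nat.eq_zero_or_pos k with h0 | h0
    · subst h0; simp_all
    · have h5 := pow_eq_zero_iff (h0.ne') |>.mp ‹_›
      rw [← map_zero (algebraMap T (Localization.Away d))] at h5
      exact hd (hinj h5)
  · intro inst hda
    rw [map_mul] at hda
    have hd' := left_ne_zero_of_mul hda
    have ha' := right_ne_zero_of_mul hda
    let φ : Localization.Away d →+* ℝ := IsLocalization.Away.lift (g := algebraMap T ℝ) d (Ne.isUnit hd')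
    let _ : Algebra (Localization.Away d) ℝ := φ.toAlgebra
    have : IsScalarTower T (Localization.Away d) ℝ := IsScalarTower.of_algebraMap_eq (fun x => by
      change _ = φ _
      simp [φ])
    have hh := h inferInstance ?_
    · have e := AlgHom.liftEquiv T (Localization.Away d) A ℝ
      have := hh.1
      exact ⟨Finite.of_equiv _ e.symm, by rw [Nat.card_congr e, hh.2]⟩
    · intro h0
      have := congrArg (algebraMap (Localization.Away d) ℝ) ha
      rw [map_mul, h0, zero_mul, ← IsScalarTower.algebraMap_apply] at this
      exact ha' this.symm

lemma PL_fin (T A : Type) [CommRing T] [IsDomain T] [IsNoetherianRing T] [CommRing A] [Algebra T A]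
    [Module.Finite T A] [Algebra.FormallyUnramified T A] :
    ∃ δ : T, ∃ ε : ℕ, δ ≠ 0 ∧ ∀ _ : Algebra T ℝ, algebraMap T ℝ δ ≠ 0 →
      Finite (A →ₐ[T] ℝ) ∧ Nat.card (A →ₐ[T] ℝ) % 2 = ε := by
  have : Module.FinitePresentation T A := Module.finitePresentation_of_finite T A
  obtain ⟨r, hr, hfree, -⟩ := Module.FinitePresentation.exists_free_localizedModule_powers
    (nonZeroDivisors T) (TensorProduct.mk T (FractionRing T) A 1) (FractionRing T)
  have hr0 : r ≠ 0 := nonZeroDivisors.ne_zero hr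
  have : Module.Free (Localization.Away r) (Localization.Away r ⊗[T] A) :=
    Module.Free.of_equiv (LocalizedModule.equivTensorProduct (Submonoid.powers r) A)
  have : Nontrivial (Localization.Away r) :=
    (IsLocalization.injective (Localization.Away r) (powers_le_nonZeroDivisors_of_noZeroDivisors hr0)).nontrivial
  obtain ⟨δ, h1, h2⟩ := PL_down T A r hr0 (Module.finrank (Localization.Away r) (Localization.Away r ⊗[T] A) % 2) 1
    one_ne_zero (fun _ _ => PL_free (Localization.Away r) (Localization.Away r ⊗[T] A))
  exact ⟨δ, _, h1, h2⟩

lemma PL_alg (T A : Type) [CommRing T] [IsDomain T] [CommRing A] [Algebra T A]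
    [Algebra.FiniteType T A] [Algebra.FormallyUnramified T A] (a : A) :
    ∃ p : Polynomial T, p ≠ 0 ∧ Polynomial.aeval a p = 0 := by
  let K := FractionRing T
  have : Module.Finite K (K ⊗[T] A) := Algebra.FormallyUnramified.finite_of_free K (K ⊗[T] A)
  obtain ⟨P, hP, hP2⟩ := Algebra.IsIntegral.isIntegral (R := K) ((1 : K) ⊗ₜ[T] a)
  obtain ⟨b, hb, hbp⟩ := IsLocalization.integerNormalization_spec (nonZeroDivisors T) P
  set p := IsLocalization.integerNormalization (nonZeroDivisors T) P
  have h1 : (TensorProduct.mk T K A 1) (Polynomial.aeval a p) = 0 := by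
    have e1 : (TensorProduct.mk T K A 1) (Polynomial.aeval a p) =
      Polynomial.aeval ((1 : K) ⊗ₜ[T] a) p := by
      have := Polynomial.aeval_algHom_apply (Algebra.TensorProduct.includeRight : A →ₐ[T] K ⊗[T] A) a p
      simpa using this.symm
    rw [e1, ← Polynomial.aeval_map_algebraMap K, hbp, ← algebraMap_smul K b P, map_smul]
    rw [Polynomial.aeval_def, hP2, smul_zero]
  obtain ⟨s, hs⟩ := (IsLocalizedModule.eq_zero_iff (nonZeroDivisors T) _).1 h1
  refine ⟨(s : T) • p, ?_, ?_⟩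
  · refine smul_ne_zero (nonZeroDivisors.ne_zero s.2) ?_
    intro h0
    rw [h0, Polynomial.map_zero] at hbp
    have : b • P ≠ 0 := smul_ne_zero (nonZeroDivisors.ne_zero hb) hP.ne_zero
    exact this hbp.symm
  · rw [map_smul]; exact hs

lemma PL_gen (T A : Type) [CommRing T] [IsDomain T] [IsNoetherianRing T] [CommRing A] [Algebra T A]
    [Algebra.FiniteType T A] [Algebra.FormallyUnramified T A] :
    ∃ δ : T, ∃ ε : ℕ, δ ≠ 0 ∧ ∀ _ : Algebra T ℝ, algebraMap T ℝ δ ≠ 0 →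
      Finite (A →ₐ[T] ℝ) ∧ Nat.card (A →ₐ[T] ℝ) % 2 = ε := by
  obtain ⟨s, hs⟩ := (inferInstance : Algebra.FiniteType T A).1
  choose p hp0 hp using PL_alg T A
  let d : T := ∏ a ∈ s, (p a).leadingCoeff
  have hd : d ≠ 0 := Finset.prod_ne_zero_iff.2 (fun a _ => by simpa using hp0 a)
  let T1 := Localization.Away d
  have : IsDomain T1 :=
    IsLocalization.isDomain_localization (powers_le_nonZeroDivisors_of_noZeroDivisors hd)
  have : IsNoetherianRing T1 := IsLocalization.isNoetherianRing (Submonoid.powers d) _ inferInstance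
  have hu : ∀ a ∈ s, IsUnit (algebraMap T T1 (p a).leadingCoeff) := by
    intro a ha
    have : IsUnit (algebraMap T T1 d) := IsLocalization.Away.algebraMap_isUnit d
    exact isUnit_of_dvd_unit (map_dvd _ (Finset.dvd_prod_of_mem (fun a => (p a).leadingCoeff) ha)) this
  have hint : ∀ a : A, IsIntegral T1 ((1 : T1) ⊗ₜ[T] a) := by
    let C : Subalgebra T A := ((integralClosure T1 (T1 ⊗[T] A)).restrictScalars T).comap
      (Algebra.TensorProduct.includeRight : A →ₐ[T] T1 ⊗[T] A)
    have hC : C = ⊤ := by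
      rw [eq_top_iff, ← hs]
      refine Algebra.adjoin_le ?_
      intro a ha
      change IsIntegral T1 ((1 : T1) ⊗ₜ[T] a)
      refine ⟨Polynomial.C (↑(hu a ha).unit⁻¹ : T1) * (p a).map (algebraMap T T1), ?_, ?_⟩
      · rw [Polynomial.Monic, Polynomial.leadingCoeff_mul, Polynomial.leadingCoeff_C,
          Polynomial.leadingCoeff_map_of_leadingCoeff_ne_zero _ (hu a ha).ne_zero]
        exact (hu a ha).val_inv_mul
      · have := Polynomial.aeval_algHom_apply (Algebra.TensorProduct.includeRight : A →ₐ[T] T1 ⊗[T] A) a (p a)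
        rw [hp, map_zero] at this
        rw [← Polynomial.aeval_def, map_mul, Polynomial.aeval_map_algebraMap]
        simp only [Algebra.TensorProduct.includeRight_apply] at this
        rw [this, mul_zero]
    intro a
    have : a ∈ C := by rw [hC]; trivial
    exact this
  have : Algebra.IsIntegral T1 (T1 ⊗[T] A) := ⟨fun x => by
    induction x with
    | zero => exact isIntegral_zero
    | add x y hx hy => exact hx.add hy
    | tmul r a =>
      have : r ⊗ₜ[T] a = r • ((1 : T1) ⊗ₜ[T] a) := by simp [TensorProduct.smul_tmul']
      rw [this]
      exact (hint a).smul r⟩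
  have : Module.Finite T1 (T1 ⊗[T] A) := Algebra.IsIntegral.finite
  obtain ⟨δ, ε, h1, h2⟩ := PL_fin T1 (T1 ⊗[T] A)
  obtain ⟨δ', h3, h4⟩ := PL_down T A d hd ε δ h1 h2
  exact ⟨δ', ε, h3, h4⟩

end Part2

section Part3
open scoped TensorProduct

noncomputable abbrev evVW {n c : ℕ} (v : Fin n → ℝ) (w : Fin c → ℝ) :
    MvPolynomial (Fin c) (MvPolynomial (Fin n) ℝ) →+* ℝ :=
  MvPolynomial.eval₂Hom (MvPolynomial.eval v) w

lemma derivation_sum_pderiv {σ T M : Type*} [Fintype σ] [CommRing T] [AddCommGroup M]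
    [Module T M] [Module (MvPolynomial σ T) M] [IsScalarTower T (MvPolynomial σ T) M]
    (D : Derivation T (MvPolynomial σ T) M) (p : MvPolynomial σ T) :
    D p = ∑ j, MvPolynomial.pderiv j p • D (MvPolynomial.X j) := by
  classical
  induction p using MvPolynomial.induction_on with
  | C a => simp
  | add p q hp hq => simp [hp, hq, add_smul, Finset.sum_add_distrib]
  | mul_X p i hp =>
    simp only [Derivation.leibniz, hp, MvPolynomial.pderiv_X, add_smul, Finset.sum_add_distrib,
      smul_assoc]
    congr 1
    · rw [Finset.sum_eq_single i]
      · simp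
      · intro b _ hb; simp [Pi.single_eq_of_ne hb.symm]
      · simp
    · rw [Finset.smul_sum]

lemma L1_unram {c : ℕ} (T : Type) [CommRing T] (S : Set (MvPolynomial (Fin c) T))
    (Nn : Fin c → MvPolynomial (Fin c) T) (hN : ∀ i, Nn i ∈ S) (Δ : MvPolynomial (Fin c) T)
    (hΔ : Matrix.det (Matrix.of fun i j => MvPolynomial.pderiv j (Nn i)) ∣ Δ) :
    Algebra.FormallyUnramified T (Localization.Away (Ideal.Quotient.mk (Ideal.span S) Δ)) := by
  let P := MvPolynomial (Fin c) T
  let R := P ⧸ Ideal.span S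
  let A := Localization.Away (Ideal.Quotient.mk (Ideal.span S) Δ)
  have tow : ∀ p : P, algebraMap P A p = algebraMap R A (Ideal.Quotient.mk _ p) := fun p => by
    rw [IsScalarTower.algebraMap_apply P R A]; rfl
  have huΔ : IsUnit (algebraMap P A Δ) := by
    rw [tow]; exact IsLocalization.Away.algebraMap_isUnit _
  let M : Matrix (Fin c) (Fin c) P := Matrix.of fun i j => MvPolynomial.pderiv j (Nn i)
  have hu : IsUnit (algebraMap P A M.det) :=
    isUnit_of_dvd_unit (map_dvd _ hΔ) huΔ
  let D := KaehlerDifferential.D T A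
  let D' : Derivation T P Ω[A⁄T] := D.compAlgebraMap P
  have hD' : ∀ p, D' p = D (algebraMap P A p) := fun p => rfl
  have hX : ∀ j, D' (MvPolynomial.X j) = 0 := by
    have h1 : ∀ i, ∑ j, M i j • D' (MvPolynomial.X j) = 0 := by
      intro i
      have h2 : D' (Nn i) = 0 := by
        rw [hD', tow, Ideal.Quotient.eq_zero_iff_mem.2 (Ideal.subset_span (hN i))]
        simp
      rw [← h2, derivation_sum_pderiv D' (Nn i)]
      rfl
    intro j
    have h3 : M.det • D' (MvPolynomial.X j) = 0 := by
      have h4 : ∑ i, M.adjugate j i • ∑ k, M i k • D' (MvPolynomial.X k) = 0 := by simp [h1]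
      have h5 : ∀ k, (∑ i, M.adjugate j i * M i k) = if j = k then M.det else 0 := by
        intro k
        rw [← Matrix.mul_apply, Matrix.adjugate_mul, Matrix.smul_apply, Matrix.one_apply]
        simp
      simp_rw [Finset.smul_sum, smul_smul] at h4
      rw [Finset.sum_comm] at h4
      simp_rw [← Finset.sum_smul, h5] at h4
      simpa using h4
    rw [← algebraMap_smul A] at h3
    exact (hu.smul_eq_zero).1 h3
  have h0 : D' = 0 := MvPolynomial.derivation_ext (fun j => by simpa using hX j)
  constructor
  rw [← Submodule.subsingleton_iff A, ← subsingleton_iff_bot_eq_top, ← KaehlerDifferential.span_range_derivation, eq_comm,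
    Submodule.span_eq_bot]
  rintro _ ⟨a, rfl⟩
  obtain ⟨k, r, hr⟩ := IsLocalization.Away.surj (Ideal.Quotient.mk (Ideal.span S) Δ) a
  obtain ⟨p, rfl⟩ := Ideal.Quotient.mk_surjective r
  rw [← tow, ← tow, ← map_pow] at hr
  have h6 := congrArg D hr
  rw [Derivation.leibniz, ← hD', ← hD', h0] at h6
  simp only [Derivation.coe_zero, Pi.zero_apply, smul_zero, zero_add, map_pow] at h6
  exact ((huΔ.pow k).smul_eq_zero).1 h6

lemma L1 {n c : ℕ} (S : Set (MvPolynomial (Fin c) (MvPolynomial (Fin n) ℝ)))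
    (Nn : Fin c → MvPolynomial (Fin c) (MvPolynomial (Fin n) ℝ)) (hN : ∀ i, Nn i ∈ S)
    (Δ : MvPolynomial (Fin c) (MvPolynomial (Fin n) ℝ))
    (hΔ : Matrix.det (Matrix.of fun i j => MvPolynomial.pderiv j (Nn i)) ∣ Δ) :
    ∃ δ : MvPolynomial (Fin n) ℝ, ∃ ε : ℕ, δ ≠ 0 ∧ ∀ v : Fin n → ℝ, MvPolynomial.eval v δ ≠ 0 →
      Nat.card {w : Fin c → ℝ // evVW v w Δ ≠ 0 ∧ ∀ h ∈ S, evVW v w h = 0} % 2 = ε := by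
  let T := MvPolynomial (Fin n) ℝ
  let P := MvPolynomial (Fin c) T
  let R := P ⧸ Ideal.span S
  let A := Localization.Away (Ideal.Quotient.mk (Ideal.span S) Δ)
  have : Algebra.FormallyUnramified T A := L1_unram T S Nn hN Δ hΔ
  have : Algebra.FiniteType R A := RingHom.finiteType_algebraMap.mp (RingHom.finiteType_holdsForLocalizationAway _ (Ideal.Quotient.mk (Ideal.span S) Δ))
  have : Algebra.FiniteType T R := inferInstance
  have : Algebra.FiniteType T A := Algebra.FiniteType.trans (S := R) inferInstance inferInstance
  obtain ⟨δ, ε, h1, h2⟩ := PL_gen T A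
  refine ⟨δ, ε, h1, fun v hv => ?_⟩
  let _ : Algebra T ℝ := (MvPolynomial.eval v).toAlgebra
  have hh := h2 inferInstance hv
  rw [← hh.2]
  congr 1
  symm
  have tow : ∀ p : P, algebraMap P A p = algebraMap R A (Ideal.Quotient.mk _ p) := fun p => by
    rw [IsScalarTower.algebraMap_apply P R A]; rfl
  have key : ∀ (ψ : A →ₐ[T] ℝ) (p : P), ψ (algebraMap P A p) =
      evVW v (fun j => ψ (algebraMap P A (MvPolynomial.X j))) p := by
    intro ψ p
    have : (ψ : A →+* ℝ).comp (algebraMap P A) = evVW v (fun j => ψ (algebraMap P A (MvPolynomial.X j))) := by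
      apply MvPolynomial.ringHom_ext
      · intro r
        have : algebraMap P A (MvPolynomial.C r) = algebraMap T A r := by
          rw [IsScalarTower.algebraMap_apply T P A]; rfl
        simp only [RingHom.comp_apply, this]
        simp
        rfl
      · intro i; simp
    exact RingHom.congr_fun this p
  have huΔ : IsUnit (algebraMap P A Δ) := by
    rw [tow]; exact IsLocalization.Away.algebraMap_isUnit _
  refine Nat.card_congr (Equiv.ofBijective (fun ψ => ⟨fun j => ψ (algebraMap P A (MvPolynomial.X j)), ?_, ?_⟩) ⟨?_, ?_⟩)
  · rw [← key]; exact (huΔ.map ψ).ne_zero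
  · intro h hS
    rw [← key, tow, Ideal.Quotient.eq_zero_iff_mem.2 (Ideal.subset_span hS)]; simp
  · intro ψ ψ' h
    simp only [Subtype.mk.injEq] at h
    have h3 : (ψ : A →+* ℝ) = ψ' := by
      refine IsLocalization.ringHom_ext (Submonoid.powers (Ideal.Quotient.mk (Ideal.span S) Δ)) ?_
      refine Ideal.Quotient.ringHom_ext ?_
      refine RingHom.ext (fun p => ?_)
      simp only [RingHom.comp_apply]
      rw [← tow]
      change ψ _ = ψ' _
      rw [key, key, h]
    exact AlgHom.coe_ringHom_injective h3
  · rintro ⟨w, hw, hw2⟩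
    let φ1 : R →+* ℝ := Ideal.Quotient.lift (Ideal.span S) (evVW v w) (by
      intro a ha
      have : Ideal.span S ≤ RingHom.ker (evVW v w) := Ideal.span_le.2 (fun h hh => hw2 h hh)
      exact this ha)
    have hφ1 : ∀ p, φ1 (Ideal.Quotient.mk _ p) = evVW v w p := fun p => rfl
    let φ2 : A →+* ℝ := IsLocalization.Away.lift (g := φ1) (Ideal.Quotient.mk (Ideal.span S) Δ) (by
      rw [hφ1]; exact Ne.isUnit hw)
    have hφ2 : ∀ p, φ2 (algebraMap P A p) = evVW v w p := fun p => by
      rw [tow]; exact IsLocalization.Away.lift_eq (Ideal.Quotient.mk (Ideal.span S) Δ) _ _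
    refine ⟨⟨φ2, ?_⟩, ?_⟩
    · intro r
      have : algebraMap P A (MvPolynomial.C r) = algebraMap T A r := by
          rw [IsScalarTower.algebraMap_apply T P A]; rfl
      change φ2 _ = _
      rw [← this, hφ2]
      simp
      rfl
    · ext j
      change φ2 _ = _
      rw [hφ2]
      simp

end Part3

section Part4
open scoped TensorProduct

noncomputable def relV {n : ℕ} {T : Type} [CommRing T] (Nn : Fin n → MvPolynomial (Fin n) T)
    (Δ : MvPolynomial (Fin n) T) : Fin n ⊕ Unit → MvPolynomial (Fin n ⊕ Unit) T :=
  Sum.elim (fun i => MvPolynomial.rename Sum.inl (Nn i))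
    (fun _ => MvPolynomial.X (Sum.inr ()) * MvPolynomial.rename Sum.inl Δ - 1)

set_option maxHeartbeats 1000000 in
lemma L5_flat {n : ℕ} (T : Type) [CommRing T] (Nn : Fin n → MvPolynomial (Fin n) T)
    (Δ : MvPolynomial (Fin n) T)
    (hΔ : Matrix.det (Matrix.of fun i j => MvPolynomial.pderiv j (Nn i)) ∣ Δ) :
    Module.Flat T (MvPolynomial (Fin n ⊕ Unit) T ⧸ Ideal.span (Set.range (relV Nn Δ))) := by
  classical
  set v := relV Nn Δ with hv
  let P := MvPolynomial (Fin n ⊕ Unit) T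
  let A := P ⧸ Ideal.span (Set.range v)
  let pre : Algebra.PreSubmersivePresentation T A (Fin n ⊕ Unit) (Fin n ⊕ Unit) :=
    Algebra.PreSubmersivePresentation.naive (v := v) id Function.injective_id
  have hu : IsUnit (Ideal.Quotient.mk (Ideal.span (Set.range v)) (MvPolynomial.rename Sum.inl Δ)) := by
    refine IsUnit.of_mul_eq_one (Ideal.Quotient.mk _ (MvPolynomial.X (Sum.inr ()))) ?_
    rw [← map_mul, ← map_one (Ideal.Quotient.mk (Ideal.span (Set.range v))), Ideal.Quotient.eq]
    refine Ideal.subset_span ⟨Sum.inr (), ?_⟩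
    simp only [hv, relV, Sum.elim_inr]; ring
  have hinr : ∀ p : MvPolynomial (Fin n) T,
      MvPolynomial.pderiv (Sum.inr () : Fin n ⊕ Unit) (MvPolynomial.rename Sum.inl p) = 0 := by
    intro p
    apply MvPolynomial.pderiv_eq_zero_of_notMem_vars
    intro h
    have := MvPolynomial.vars_rename _ _ h
    simp at this
  have hmat : pre.jacobiMatrix = Matrix.fromBlocks
      ((Matrix.of fun i j => MvPolynomial.rename Sum.inl (MvPolynomial.pderiv j (Nn i))).transpose)
      (Matrix.of fun i _ => MvPolynomial.pderiv (Sum.inl i) (v (Sum.inr ())))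
      0 (Matrix.of fun _ _ => MvPolynomial.rename Sum.inl Δ) := by
    ext1 i j
    rw [Algebra.PreSubmersivePresentation.jacobiMatrix_naive]
    rcases i with i | i <;> rcases j with j | j
    · simp [hv, relV, MvPolynomial.pderiv_rename Sum.inl_injective]
    · simp
    · simp [hv, relV, hinr]
    · simp [hv, relV, hinr]
  have hdet : pre.jacobiMatrix.det = (MvPolynomial.rename Sum.inl
      ((Matrix.of fun i j => MvPolynomial.pderiv j (Nn i)).det * Δ) : P) := by
    rw [hmat, Matrix.det_fromBlocks_zero₂₁, Matrix.det_transpose]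
    have e1 : (Matrix.of fun i j => MvPolynomial.rename (Sum.inl : Fin n → Fin n ⊕ Unit) (MvPolynomial.pderiv j (Nn i))).det =
        MvPolynomial.rename Sum.inl (Matrix.of fun i j => MvPolynomial.pderiv j (Nn i)).det := by
      rw [AlgHom.map_det]; rfl
    rw [e1, map_mul]
    congr 1
    rw [Matrix.det_unique]; rfl
  have e2 : ∀ p : P, algebraMap pre.Ring A p = Ideal.Quotient.mk _ p := fun p => by
    have := Algebra.Generators.algebraMap_apply pre.toGenerators p
    rw [this]
    have h3 : (MvPolynomial.aeval pre.val : P →ₐ[T] A) = Ideal.Quotient.mkₐ T _ := by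
      apply MvPolynomial.algHom_ext
      intro i; simp; rfl
    exact AlgHom.congr_fun h3 p
  have hjac : IsUnit pre.jacobian := by
    have e3 : pre.jacobian = Ideal.Quotient.mk _ (MvPolynomial.rename Sum.inl
      ((Matrix.of fun i j => MvPolynomial.pderiv j (Nn i)).det * Δ)) := by
      rw [Algebra.PreSubmersivePresentation.jacobian_eq_jacobiMatrix_det, hdet, e2]
    rw [e3, map_mul, map_mul]
    exact IsUnit.mul (isUnit_of_dvd_unit (map_dvd _ (map_dvd _ hΔ)) hu) hu
  let sub : Algebra.SubmersivePresentation T A (Fin n ⊕ Unit) (Fin n ⊕ Unit) := ⟨pre, hjac⟩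
  have : Algebra.IsStandardSmooth T A := sub.isStandardSmooth
  have : Algebra.Smooth T A := inferInstance
  exact Algebra.Smooth.flat T A

end Part4

section Part5
open scoped TensorProduct
open MvPolynomial in
set_option maxHeartbeats 1000000 in
lemma L5 {n : ℕ} (p q : Fin n → MvPolynomial (Fin n) ℝ) (a b : MvPolynomial (Fin n) ℝ) (k : Fin n)
    (hcop : ∀ t, b ∣ a * t → b ∣ t)
    (hq : ∀ i, q i ≠ 0)
    (hid : aeval (fun i => algebraMap _ (FractionRing (MvPolynomial (Fin n) ℝ)) (p i) / algebraMap _ (FractionRing (MvPolynomial (Fin n) ℝ)) (q i)) b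
       * algebraMap (MvPolynomial (Fin n) ℝ) (FractionRing (MvPolynomial (Fin n) ℝ)) (X k) =
       aeval (fun i => algebraMap _ (FractionRing (MvPolynomial (Fin n) ℝ)) (p i) / algebraMap _ (FractionRing (MvPolynomial (Fin n) ℝ)) (q i)) a)
    (x0 y0 : Fin n → ℝ) (hq0 : ∀ i, eval x0 (q i) ≠ 0) (hy : ∀ i, y0 i * eval x0 (q i) = eval x0 (p i))
    (hdet : (Matrix.of fun i j => y0 i * eval x0 (pderiv j (q i)) - eval x0 (pderiv j (p i))).det ≠ 0) :
    eval y0 b ≠ 0 := by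
  classical
  let T := MvPolynomial (Fin n) ℝ
  let K := FractionRing T
  let Nn : Fin n → MvPolynomial (Fin n) T := fun i => C (X i) * map C (q i) - map C (p i)
  let J : MvPolynomial (Fin n) T := (Matrix.of fun i j => pderiv j (Nn i)).det
  let Δ : MvPolynomial (Fin n) T := (∏ i, map C (q i)) * J
  let P := MvPolynomial (Fin n ⊕ Unit) T
  let A := P ⧸ Ideal.span (Set.range (relV Nn Δ))
  have hflat : Module.Flat T A := L5_flat T Nn Δ (Dvd.intro_left _ rfl)
  let mk : P →+* A := Ideal.Quotient.mk (Ideal.span (Set.range (relV Nn Δ)))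
  have mkalg : ∀ t : T, algebraMap T A t = mk (C t) := fun t => rfl
  have rel : ∀ i, mk (relV Nn Δ i) = 0 := fun i =>
    Ideal.Quotient.eq_zero_iff_mem.2 (Ideal.subset_span ⟨i, rfl⟩)
  -- map from ℝ[x]
  let ι : T →+* A := mk.comp ((rename Sum.inl).toRingHom.comp (map C))
  have hι : ∀ t, ι t = mk (rename Sum.inl (map C t)) := fun t => rfl
  have hιX : ∀ i, ι (X i) = mk (X (Sum.inl i)) := fun i => by simp [hι]
  have huΔ : IsUnit (mk (rename Sum.inl Δ)) := by
    have := rel (Sum.inr ())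
    simp only [relV, Sum.elim_inr, map_sub, map_mul, map_one] at this
    refine IsUnit.of_mul_eq_one (mk (X (Sum.inr ()))) ?_
    linear_combination this
  have huQ : IsUnit (ι (∏ i, q i)) := by
    rw [hι, map_prod]
    exact isUnit_of_dvd_unit (map_dvd _ (map_dvd _ (Dvd.intro _ rfl))) huΔ
  have huq : ∀ i, IsUnit (ι (q i)) := fun i =>
    isUnit_of_dvd_unit (map_dvd _ (Finset.dvd_prod_of_mem q (Finset.mem_univ i))) huQ
  have hrel : ∀ i, algebraMap T A (X i) * ι (q i) = ι (p i) := by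
    intro i
    have := rel (Sum.inl i)
    simp only [relV, Sum.elim_inl, Nn, map_sub, map_mul, rename_C] at this
    rw [mkalg, hι, hι]
    linear_combination this
  -- localization
  let Q : T := ∏ i, q i
  have hQ : Q ≠ 0 := Finset.prod_ne_zero_iff.2 (fun i _ => hq i)
  let E := Localization.Away Q
  have hQE : IsUnit (algebraMap T E Q) := IsLocalization.Away.algebraMap_isUnit Q
  have hqE : ∀ i, IsUnit (algebraMap T E (q i)) := fun i =>
    isUnit_of_dvd_unit (map_dvd _ (Finset.dvd_prod_of_mem q (Finset.mem_univ i))) hQE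
  let ψ : E →+* A := IsLocalization.Away.lift (g := ι) Q huQ
  have hψ : ∀ t, ψ (algebraMap T E t) = ι t := fun t => IsLocalization.Away.lift_eq Q _ _
  have hKQ : algebraMap T K Q ≠ 0 := by
    simpa using hQ
  let κ : E →+* K := IsLocalization.Away.lift (g := algebraMap T K) Q hKQ.isUnit
  have hκ : ∀ t, κ (algebraMap T E t) = algebraMap T K t := fun t => IsLocalization.Away.lift_eq Q _ _
  have hκinj : Function.Injective κ := by
    rw [injective_iff_map_eq_zero]
    intro z hz
    obtain ⟨m, r, hr⟩ := IsLocalization.Away.surj Q z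
    have h1 := congrArg κ hr
    rw [map_mul, hz, zero_mul, hκ] at h1
    have h2 : r = 0 := by simpa using h1.symm
    rw [h2, map_zero] at hr
    exact (hQE.pow m).mul_left_eq_zero.1 hr
  let f0 : Fin n → E := fun i => algebraMap T E (p i) * ↑((hqE i).unit⁻¹)
  have hf0 : ∀ i, f0 i * algebraMap T E (q i) = algebraMap T E (p i) := fun i => by
    simp only [f0, mul_assoc, IsUnit.val_inv_mul, mul_one]
  have hκf : ∀ i, κ (f0 i) = algebraMap T K (p i) / algebraMap T K (q i) := fun i => by
    have h1 := congrArg κ (hf0 i)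
    rw [map_mul, hκ, hκ] at h1
    have : algebraMap T K (q i) ≠ 0 := by simpa using hq i
    rw [eq_div_iff this]; exact h1
  have hψf : ∀ i, ψ (f0 i) = algebraMap T A (X i) := fun i => by
    have h1 := congrArg ψ (hf0 i)
    rw [map_mul, hψ, hψ, ← hrel] at h1
    exact (huq i).mul_right_cancel h1
  have hκa : ∀ t : T, κ (aeval f0 t) = aeval (fun i => algebraMap T K (p i) / algebraMap T K (q i)) t := by
    intro t
    have : κ.comp (aeval f0 : T →ₐ[ℝ] E).toRingHom =
      (aeval (fun i => algebraMap T K (p i) / algebraMap T K (q i)) : T →ₐ[ℝ] K).toRingHom := by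
      apply MvPolynomial.ringHom_ext
      · intro r
        have : algebraMap ℝ E r = algebraMap T E (C r) := by
          rw [IsScalarTower.algebraMap_apply ℝ T E]; rfl
        simp [this, hκ]
        rw [IsScalarTower.algebraMap_apply ℝ T K]; rfl
      · intro i
        simp [hκf]
    exact RingHom.congr_fun this t
  have hψa : ∀ t : T, ψ (aeval f0 t) = algebraMap T A t := by
    intro t
    have : ψ.comp (aeval f0 : T →ₐ[ℝ] E).toRingHom = algebraMap T A := by
      apply MvPolynomial.ringHom_ext
      · intro r
        have : algebraMap ℝ E r = algebraMap T E (C r) := by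
          rw [IsScalarTower.algebraMap_apply ℝ T E]; rfl
        simp [this, hψ]
        rw [hι, mkalg]; simp
      · intro i
        simp [hψf]
    exact RingHom.congr_fun this t
  have hE : aeval f0 b * algebraMap T E (X k) = aeval f0 a := by
    apply hκinj
    rw [map_mul, hκa, hκa, hκ]
    exact hid
  have hA : algebraMap T A b * ι (X k) = algebraMap T A a := by
    have := congrArg ψ hE
    rwa [map_mul, hψa, hψa, hψ] at this
  -- evaluation
  intro hb0
  let _ : Algebra T ℝ := (eval y0).toAlgebra
  have halg : ∀ t, algebraMap T ℝ t = eval y0 t := fun t => rfl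
  let ev1 : MvPolynomial (Fin n) T →+* ℝ := eval₂Hom (eval y0) x0
  have hev1 : ∀ t : T, ev1 (map C t) = eval x0 t := by
    intro t
    simp only [ev1, coe_eval₂Hom, eval₂_map]
    have : (eval y0).comp C = RingHom.id ℝ := by ext; simp
    rw [this]; rfl
  have hev1Δ : ev1 Δ ≠ 0 := by
    simp only [Δ, map_mul, map_prod, hev1, J]
    refine mul_ne_zero (Finset.prod_ne_zero_iff.2 (fun i _ => hq0 i)) ?_
    rw [RingHom.map_det]
    convert hdet using 2
    ext i j
    simp only [RingHom.mapMatrix_apply, Matrix.map_apply, Matrix.of_apply, Nn, map_sub, pderiv_C_mul, map_mul, pderiv_map, hev1]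
    congr 2
    simp only [ev1, coe_eval₂Hom, eval₂_C]
    exact eval_X i
  let ev : P →ₐ[T] ℝ := aeval (Sum.elim x0 (fun _ => (ev1 Δ)⁻¹))
  have hev : ∀ t : MvPolynomial (Fin n) T, ev (rename Sum.inl t) = ev1 t := by
    intro t
    exact (aeval_rename (R := MvPolynomial (Fin n) ℝ) (S := ℝ) Sum.inl (Sum.elim x0 (fun _ => (ev1 Δ)⁻¹)) t).trans rfl
  let evA : A →ₐ[T] ℝ := Ideal.Quotient.liftₐ _ ev (by
    intro z hz
    have : Ideal.span (Set.range (relV Nn Δ)) ≤ RingHom.ker ev := by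
      rw [Ideal.span_le]
      rintro _ ⟨i | i, rfl⟩
      · change ev _ = 0
        simp only [relV, Sum.elim_inl, hev]
        simp only [Nn, map_sub, map_mul, hev1, sub_eq_zero, ← hy]
        congr 1
        simp only [ev1, coe_eval₂Hom, eval₂_C]
        exact eval_X i
      · change ev _ = 0
        simp only [relV, Sum.elim_inr, map_sub, map_mul, hev, map_one]
        have hx : ev (X (Sum.inr ())) = (ev1 Δ)⁻¹ := aeval_X _ _
        have hi : i = () := rfl
        rw [hx, inv_mul_cancel₀ hev1Δ, sub_self]
    exact this hz)
  let B := T ⧸ Ideal.span {b}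
  let evB : B →ₐ[T] ℝ := Ideal.Quotient.liftₐ _ (Algebra.ofId T ℝ) (by
    intro z hz
    obtain ⟨c, rfl⟩ := Ideal.mem_span_singleton.1 hz
    rw [map_mul]
    change eval y0 b * _ = 0
    rw [hb0, zero_mul])
  let m : B →ₗ[T] B := LinearMap.lsmul T B a
  have hm : Function.Injective m := by
    rw [injective_iff_map_eq_zero]
    intro z hz
    obtain ⟨t, rfl⟩ := Ideal.Quotient.mk_surjective z
    change Ideal.Quotient.mk _ (a * t) = 0 at hz
    rw [Ideal.Quotient.eq_zero_iff_mem, Ideal.mem_span_singleton] at hz ⊢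
    exact hcop t hz
  have hm2 := Module.Flat.lTensor_preserves_injective_linearMap (M := A) m hm
  have hz : LinearMap.lTensor A m (1 ⊗ₜ 1) = 0 := by
    rw [LinearMap.lTensor_tmul]
    change (1 : A) ⊗ₜ[T] (a • (1 : B)) = 0
    have hs : a • (1 : A) = b • ι (X k) := by
      have e1 : a • (1 : A) = algebraMap T A a := (Algebra.algebraMap_eq_smul_one a).symm
      have e2 : b • ι (X k) = algebraMap T A b * ι (X k) := by
        rw [← one_mul (ι (X k)), ← smul_mul_assoc, one_mul]
        have e3 : b • (1 : A) = algebraMap T A b := (Algebra.algebraMap_eq_smul_one b).symm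
        rw [e3]
      rw [e1, e2, hA]
    rw [← TensorProduct.smul_tmul, hs, TensorProduct.smul_tmul]
    have : b • (1 : B) = 0 := by
      change Ideal.Quotient.mk _ (b * 1) = 0
      rw [mul_one, Ideal.Quotient.eq_zero_iff_mem, Ideal.mem_span_singleton]
    rw [this, TensorProduct.tmul_zero]
  have h1 : (1 : A) ⊗ₜ[T] (1 : B) = 0 := hm2 (by rw [hz, map_zero])
  have h2 := congrArg (Algebra.TensorProduct.productMap evA evB) h1
  simp at h2

end Part5

section Part6

open MvPolynomial in
noncomputable def dP {σ : Type} [Fintype σ] (h : MvPolynomial σ ℝ) (y : σ → ℝ) : (σ → ℝ) →L[ℝ] ℝ :=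
  ∑ k, eval y (pderiv k h) • ContinuousLinearMap.proj k

open MvPolynomial in
lemma dP_apply {σ : Type} [Fintype σ] (h : MvPolynomial σ ℝ) (y e : σ → ℝ) :
    dP h y e = ∑ k, eval y (pderiv k h) * e k := by
  simp [dP]

open MvPolynomial in
lemma hasStrict_eval {σ : Type} [Fintype σ] (h : MvPolynomial σ ℝ) (y : σ → ℝ) :
    HasStrictFDerivAt (fun y => eval y h) (dP h y) y := by
  classical
  induction h using MvPolynomial.induction_on with
  | C a =>
    have : dP (C a : MvPolynomial σ ℝ) y = 0 := by ext; simp [dP]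
    rw [this]; simpa using hasStrictFDerivAt_const a y
  | add p q hp hq =>
    have : dP (p + q) y = dP p y + dP q y := by
      simp [dP, add_smul, Finset.sum_add_distrib]
    rw [this]; refine (hp.add hq).congr_of_eventuallyEq (Filter.Eventually.of_forall fun z => by simp)
  | mul_X p i hp =>
    have h2 := hp.mul (ContinuousLinearMap.proj (R := ℝ) (φ := fun _ : σ => ℝ) i).hasStrictFDerivAt (x := y)
    have : dP (p * X i) y = eval y p • (ContinuousLinearMap.proj (R := ℝ) (φ := fun _ : σ => ℝ) i) + y i • dP p y := by
      ext e
      simp only [dP_apply, Derivation.leibniz, smul_eq_mul, pderiv_X, map_add, map_mul, eval_X, add_mul,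
        Finset.sum_add_distrib, add_apply, smul_apply, Finset.mul_sum]
      congr 1
      · rw [Finset.sum_eq_single i]
        · simp
        · intro b _ hb; simp [Pi.single_eq_of_ne hb.symm]
        · simp
      · simp [mul_assoc]
    rw [this]
    exact HasStrictFDerivAt.congr_of_eventuallyEq h2 (Filter.Eventually.of_forall fun z => by simp)

open MvPolynomial in
lemma cont_eval {σ : Type} [Fintype σ] (h : MvPolynomial σ ℝ) : Continuous (fun y => eval y h) :=
  MvPolynomial.continuous_eval h

open MvPolynomial in
noncomputable def dPoly {σ : Type} [Fintype σ] (h : MvPolynomial σ ℝ) (e : σ → ℝ) : MvPolynomial σ ℝ :=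
  ∑ k, C (e k) * pderiv k h

open MvPolynomial in
lemma eval_dPoly {σ : Type} [Fintype σ] (h : MvPolynomial σ ℝ) (y e : σ → ℝ) :
    eval y (dPoly h e) = dP h y e := by
  simp [dPoly, dP_apply, mul_comm]

/-- L3 -/
lemma L3 {n : ℕ} (B : MvPolynomial (Fin n) ℝ) (hB : B ≠ 0) (R : ℝ) (hR : 0 < R) :
    ∃ v : Fin n → ℝ, ∀ y, ‖y - v‖ ≤ R → MvPolynomial.eval y B ≠ 0 := by
  classical
  set d := B.totalDegree with hd
  have htop : MvPolynomial.homogeneousComponent d B ≠ 0 := by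
    have hne : B.support.Nonempty := MvPolynomial.support_nonempty.2 hB
    obtain ⟨m, hm, hm2⟩ := Finset.exists_mem_eq_sup B.support hne (fun s => s.sum fun _ e => e)
    intro h0
    have h1 := MvPolynomial.coeff_homogeneousComponent d B m
    have h2 : m.degree = d := by rw [hd]; exact hm2.symm
    rw [h0, if_pos h2] at h1
    exact MvPolynomial.mem_support_iff.1 hm (by simpa using h1.symm)
  obtain ⟨e, he⟩ : ∃ e, MvPolynomial.eval e (MvPolynomial.homogeneousComponent d B) ≠ 0 := by
    by_contra! hh
    exact htop (MvPolynomial.funext (fun x => by rw [hh x, map_zero]))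
  let Φ : ℝ × (Fin n → ℝ) → ℝ := fun p => ∑ j ∈ Finset.range (d+1), p.1 ^ (d - j) *
    MvPolynomial.eval p.2 (MvPolynomial.homogeneousComponent j B)
  have hΦc : Continuous Φ := by
    refine continuous_finsetSum _ fun j _ => (continuous_fst.pow _).mul ((MvPolynomial.continuous_eval _).comp continuous_snd)
  have hΦ0 : Φ (0, e) ≠ 0 := by
    have : Φ (0, e) = MvPolynomial.eval e (MvPolynomial.homogeneousComponent d B) := by
      simp only [Φ]
      rw [Finset.sum_eq_single d]
      · simp
      · intro j hj hne
        have : d - j ≠ 0 := by have := Finset.mem_range.1 hj; omega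
        simp [this]
      · simp
    rwa [this]
  have hev : ∀ᶠ p in nhds ((0 : ℝ), e), Φ p ≠ 0 := hΦc.continuousAt.eventually_ne hΦ0
  rw [Metric.eventually_nhds_iff] at hev
  obtain ⟨r, hr, hball⟩ := hev
  let τ := min (r/2) (r / (2*R))
  have hτ : 0 < τ := by positivity
  have hτr : τ < r := lt_of_le_of_lt (min_le_left _ _) (by linarith)
  have hτR : τ * R < r := by
    have : τ ≤ r/(2*R) := min_le_right _ _
    calc τ * R ≤ r/(2*R)*R := by gcongr
      _ = r/2 := by field_simp
      _ < r := by linarith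
  refine ⟨τ⁻¹ • e, fun y hy h0 => ?_⟩
  have h1 : Φ (τ, τ • y) ≠ 0 := by
    apply hball
    rw [Prod.dist_eq, max_lt_iff]
    constructor
    · simpa [abs_of_pos hτ] using hτr
    · have : τ • y - e = τ • (y - τ⁻¹ • e) := by
        rw [smul_sub, smul_smul, mul_inv_cancel₀ hτ.ne', one_smul]
      rw [dist_eq_norm, this, norm_smul, Real.norm_of_nonneg hτ.le]
      exact lt_of_le_of_lt (by gcongr) hτR
  apply h1
  have h2 : Φ (τ, τ • y) = τ ^ d * MvPolynomial.eval y B := by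
    conv_rhs => rw [← MvPolynomial.sum_homogeneousComponent B]
    rw [map_sum, Finset.mul_sum]
    refine Finset.sum_congr rfl fun j hj => ?_
    have hj' := Finset.mem_range.1 hj
    have hh := MvPolynomial.homogeneousComponent_isHomogeneous j B
    have h3 : MvPolynomial.eval (τ • y) (MvPolynomial.homogeneousComponent j B) = τ ^ j * MvPolynomial.eval y (MvPolynomial.homogeneousComponent j B) := by
      rw [MvPolynomial.eval_eq', MvPolynomial.eval_eq', Finset.mul_sum]
      refine Finset.sum_congr rfl fun m hm => ?_
      have h4 := hh (MvPolynomial.mem_support_iff.1 hm)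
      have h5 : ∑ i, m i = j := by
        rw [← h4, Finsupp.weight_apply, Finsupp.sum_fintype] <;> simp
      rw [← h5]
      simp only [Pi.smul_apply, smul_eq_mul, mul_pow, Finset.prod_mul_distrib, Finset.prod_pow_eq_pow_sum]
      ring
    simp only [h3]
    rw [← mul_assoc, ← pow_add]
    congr 2; omega
  rw [h2, h0, mul_zero]

end Part6

section Part7
open MvPolynomial

lemma L4_max {n : ℕ} (B : MvPolynomial (Fin n) ℝ) (hne : ∃ z, eval z B = 0) :
    ∃ (c : ℕ) (g : Fin c → MvPolynomial (Fin n) ℝ) (z0 : Fin n → ℝ) (C : Fin c → Fin n → ℝ),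
      eval z0 B = 0 ∧ (∀ i z, eval z B = 0 → eval z (g i) = 0) ∧
      (∀ i j, dP (g i) z0 (C j) = if i = j then 1 else 0) ∧
      (∀ (g : Fin c ⊕ Fin 1 → MvPolynomial (Fin n) ℝ) (C : Fin c ⊕ Fin 1 → Fin n → ℝ) (z : Fin n → ℝ),
        eval z B = 0 → (∀ i z, eval z B = 0 → eval z (g i) = 0) →
        (Matrix.of fun i j => dP (g i) z (C j)).det = 0) := by
  classical
  let P : ℕ → Prop := fun c => ∃ (g : Fin c → MvPolynomial (Fin n) ℝ) (z0 : Fin n → ℝ) (C : Fin c → Fin n → ℝ),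
      eval z0 B = 0 ∧ (∀ i z, eval z B = 0 → eval z (g i) = 0) ∧
      (Matrix.of fun i j => dP (g i) z0 (C j)).det ≠ 0
  have hle : ∀ c, P c → c ≤ n := by
    rintro c ⟨g, z0, C, -, -, hd⟩
    by_contra! hlt
    have hM : (Matrix.of fun i j => dP (g i) z0 (C j)) =
        (Matrix.of fun i k => eval z0 (pderiv k (g i))) * (Matrix.of fun k j => C j k) := by
      ext i j
      simp [Matrix.mul_apply, dP_apply]
    have hr := Matrix.rank_of_isUnit _ ((Matrix.isUnit_iff_isUnit_det _).2 hd.isUnit)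
    rw [hM] at hr
    have h1 := Matrix.rank_mul_le_left (Matrix.of fun (i : Fin c) (k : Fin n) => eval z0 (pderiv k (g i))) (Matrix.of fun k j => C j k)
    have h2 := Matrix.rank_le_width (Matrix.of fun (i : Fin c) (k : Fin n) => eval z0 (pderiv k (g i)))
    simp at hr
    omega
  have h0 : P 0 := by
    obtain ⟨z, hz⟩ := hne
    exact ⟨fun i => i.elim0, z, fun i => i.elim0, hz, fun i => i.elim0, by simp⟩
  let c := Nat.findGreatest P n
  have hc : P c := Nat.findGreatest_spec (Nat.zero_le n) h0
  have hc1 : ¬ P (c+1) := by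
    intro h
    have := Nat.le_findGreatest (hle _ h) h
    omega
  obtain ⟨g, z0, C, hz0, hg, hd⟩ := hc
  set A := (Matrix.of fun i j => dP (g i) z0 (C j)) with hA
  refine ⟨c, g, z0, fun j => ∑ k, A⁻¹ k j • C k, hz0, hg, ?_, ?_⟩
  · intro i j
    have h1 : A * A⁻¹ = 1 := Matrix.mul_nonsing_inv _ hd.isUnit
    have h2 := congrFun (congrFun h1 i) j
    rw [Matrix.mul_apply, Matrix.one_apply] at h2
    rw [← h2, map_sum]
    refine Finset.sum_congr rfl fun k _ => ?_
    simp [hA, mul_comm]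
  · intro g' C' z hz hg'
    by_contra hdet
    apply hc1
    refine ⟨fun i => g' (finSumFinEquiv.symm i), z, fun i => C' (finSumFinEquiv.symm i), hz, fun i => hg' _, ?_⟩
    have := Matrix.det_submatrix_equiv_self (finSumFinEquiv (m := c) (n := 1)).symm (Matrix.of fun i j => dP (g' i) z (C' j))
    rw [← this] at hdet
    exact hdet

lemma det_border {c : ℕ} (A : Matrix (Fin c) (Fin c) ℝ) (r : Fin c → ℝ) (d : ℝ) (M : Matrix (Fin c ⊕ Fin 1) (Fin c ⊕ Fin 1) ℝ)
    (h11 : ∀ i j, M (Sum.inl i) (Sum.inl j) = A i j) (h12 : ∀ i j, M (Sum.inl i) (Sum.inr j) = 0)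
    (h22 : ∀ i j, M (Sum.inr i) (Sum.inr j) = d) : M.det = A.det * d := by
  have : M = Matrix.fromBlocks A 0 (Matrix.of fun i j => M (Sum.inr i) (Sum.inl j)) (Matrix.of fun _ _ => d) := by
    ext (i | i) (j | j) <;> simp [h11, h12, h22]
  rw [this, Matrix.det_fromBlocks_zero₁₂]
  simp

/-- The derivative estimate. -/
lemma L4_est {n c : ℕ} (B : MvPolynomial (Fin n) ℝ)
    (g : Fin c → MvPolynomial (Fin n) ℝ) (C : Fin c → Fin n → ℝ)
    (hg : ∀ i z, eval z B = 0 → eval z (g i) = 0)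
    (hmax : ∀ (g : Fin c ⊕ Fin 1 → MvPolynomial (Fin n) ℝ) (C : Fin c ⊕ Fin 1 → Fin n → ℝ) (z : Fin n → ℝ),
        eval z B = 0 → (∀ i z, eval z B = 0 → eval z (g i) = 0) →
        (Matrix.of fun i j => dP (g i) z (C j)).det = 0) :
    ∃ (s : Finset (MvPolynomial (Fin n) ℝ)) (r : s → Fin n → s → MvPolynomial (Fin n) ℝ),
      (∀ h ∈ s, ∀ z, eval z B = 0 → eval z h = 0) ∧
      (∀ z, (∀ h ∈ s, eval z h = 0) → eval z B = 0) ∧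
      ∀ (h : s) (y e : Fin n → ℝ), (∀ i, dP (g i) y e = 0) →
        (Matrix.of fun i j => dP (g i) y (C j)).det * dP h.1 y e =
          ∑ l, e l * ∑ h' : s, eval y (r h l h') * eval y h'.1 := by
  classical
  let I : Ideal (MvPolynomial (Fin n) ℝ) :=
    { carrier := {h | ∀ z, eval z B = 0 → eval z h = 0}
      add_mem' := fun {a b} ha hb z hz => by rw [map_add, ha z hz, hb z hz, add_zero]
      zero_mem' := fun z _ => map_zero _
      smul_mem' := fun a b hb z hz => by rw [smul_eq_mul, map_mul, hb z hz, mul_zero] }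
  obtain ⟨s, hs⟩ : I.FG := IsNoetherian.noetherian I
  have hsI : ∀ h ∈ s, h ∈ I := fun h hh => hs ▸ Ideal.subset_span hh
  let DD : MvPolynomial (Fin n) ℝ → (Fin n → ℝ) → MvPolynomial (Fin n) ℝ := fun h e =>
    (Matrix.of fun i j => dPoly (Sum.elim g (fun _ => h) i : MvPolynomial (Fin n) ℝ)
      ((Sum.elim C (fun _ => e) : Fin c ⊕ Fin 1 → _) j)).det
  have hDD : ∀ h e y, eval y (DD h e) = (Matrix.of fun i j => dP ((Sum.elim g (fun _ => h) : Fin c ⊕ Fin 1 → _) i : MvPolynomial (Fin n) ℝ) y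
      ((Sum.elim C (fun _ => e) : Fin c ⊕ Fin 1 → _) j)).det := by
    intro h e y
    simp only [DD, RingHom.map_det]
    congr 1
    ext i j
    simp [eval_dPoly]
  have hDI : ∀ h ∈ s, ∀ e, DD h e ∈ I := by
    intro h hh e z hz
    rw [hDD]
    apply hmax _ _ z hz
    rintro (i | i) z hz
    · exact hg i z hz
    · exact hsI h hh z hz
  have hex : ∀ (h : s) (l : Fin n), ∃ r : s → MvPolynomial (Fin n) ℝ, ∑ a : s, r a • a.1 = DD h.1 (Pi.single l 1) := by
    intro h l
    have := hDI h.1 h.2 (Pi.single l 1)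
    rw [← hs] at this
    exact Submodule.mem_span_finset'.1 this
  choose r hr using hex
  refine ⟨s, r, fun h hh => hsI h hh, ?_, ?_⟩
  · intro z hz
    have hB : B ∈ I := fun z hz => hz
    rw [← hs] at hB
    obtain ⟨f, hf⟩ := Submodule.mem_span_finset'.1 hB
    rw [← hf, map_sum]
    refine Finset.sum_eq_zero fun a _ => ?_
    rw [smul_eq_mul, map_mul, hz a.1 a.2, mul_zero]
  · intro h y e he
    have h1 : eval y (DD h.1 e) = (Matrix.of fun i j => dP (g i) y (C j)).det * dP h.1 y e := by
      rw [hDD]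
      apply det_border _ (fun _ => 0)
      · intro i j; simp
      · intro i j; simp [he]
      · intro i j; simp
    rw [← h1]
    -- linearity in e
    have h2 : ∀ e, eval y (DD h.1 e) = ∑ l, e l * eval y (DD h.1 (Pi.single l 1)) := by
      intro e
      let M : Matrix (Fin c ⊕ Fin 1) (Fin c ⊕ Fin 1) ℝ := Matrix.of fun i j => dP ((Sum.elim g (fun _ => h.1) : Fin c ⊕ Fin 1 → _) i : MvPolynomial (Fin n) ℝ) y
        ((Sum.elim C (fun _ => 0) : Fin c ⊕ Fin 1 → _) j)
      have h3 : ∀ e, eval y (DD h.1 e) = (M.updateCol (Sum.inr 0) (fun i => dP ((Sum.elim g (fun _ => h.1) : Fin c ⊕ Fin 1 → _) i : MvPolynomial (Fin n) ℝ) y e)).det := by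
        intro e
        rw [hDD]
        congr 1
        ext i (j | j)
        · simp [M, Matrix.updateCol_apply]
        · have : j = 0 := Subsingleton.elim _ _
          subst this
          simp [M, Matrix.updateCol_apply]
      let lin : (Fin n → ℝ) →ₗ[ℝ] ℝ :=
        (LinearMap.proj (Sum.inr 0)).comp ((Matrix.cramer M : (Fin c ⊕ Fin 1 → ℝ) →ₗ[ℝ] (Fin c ⊕ Fin 1 → ℝ)).comp
          (LinearMap.pi (fun i => (dP ((Sum.elim g (fun _ => h.1) : Fin c ⊕ Fin 1 → _) i : MvPolynomial (Fin n) ℝ) y).toLinearMap)))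
      have h4 : ∀ e, eval y (DD h.1 e) = lin e := by
        intro e
        rw [h3]
        simp only [lin, LinearMap.comp_apply, LinearMap.proj_apply, Matrix.cramer_apply]
        rfl
      rw [h4, LinearMap.pi_apply_eq_sum_univ lin e]
      refine Finset.sum_congr rfl fun l _ => ?_
      rw [h4, smul_eq_mul]
      congr 2
      ext j
      simp [Pi.single_apply, eq_comm]
    rw [h2 e]
    refine Finset.sum_congr rfl fun l _ => ?_
    rw [← hr, map_sum]
    simp

end Part7

section Part8
open MvPolynomial

noncomputable def gvec {n c : ℕ} (g : Fin c → MvPolynomial (Fin n) ℝ) (y : Fin n → ℝ) : Fin c → ℝ :=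
  fun i => eval y (g i)
noncomputable def Dg {n c : ℕ} (g : Fin c → MvPolynomial (Fin n) ℝ) (y : Fin n → ℝ) :
    (Fin n → ℝ) →L[ℝ] (Fin c → ℝ) :=
  ContinuousLinearMap.pi fun i => dP (g i) y
lemma gvec_strict {n c : ℕ} (g : Fin c → MvPolynomial (Fin n) ℝ) (y : Fin n → ℝ) :
    HasStrictFDerivAt (gvec g) (Dg g y) y := by
  rw [hasStrictFDerivAt_pi']
  intro i
  exact hasStrict_eval (g i) y
lemma Dg_cont {n c : ℕ} (g : Fin c → MvPolynomial (Fin n) ℝ) : Continuous (Dg g) := by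
  have h : Dg g = fun y => ∑ i, ∑ k, eval y (pderiv k (g i)) •
      ((ContinuousLinearMap.proj (R := ℝ) (φ := fun _ : Fin n => ℝ) k).smulRight (Pi.single i (1:ℝ) : Fin c → ℝ)) := by
    funext y
    ext e i
    simp [Dg, dP_apply, Finset.sum_apply, Pi.single_apply]
  rw [h]
  refine continuous_finsetSum _ fun i _ => continuous_finsetSum _ fun k _ => ?_
  exact (cont_eval _).smul continuous_const
noncomputable def Cmap {n c : ℕ} (C : Fin c → Fin n → ℝ) : (Fin c → ℝ) →L[ℝ] (Fin n → ℝ) :=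
  ∑ j, (ContinuousLinearMap.proj (R := ℝ) (φ := fun _ : Fin c => ℝ) j).smulRight (C j)
lemma Cmap_apply {n c : ℕ} (C : Fin c → Fin n → ℝ) (w) : Cmap C w = ∑ j, w j • C j := by
  simp [Cmap]
lemma Dg_Cmap {n c : ℕ} (g : Fin c → MvPolynomial (Fin n) ℝ) (z0) (C : Fin c → Fin n → ℝ)
    (h : ∀ i j, dP (g i) z0 (C j) = if i = j then 1 else 0) (w) : Dg g z0 (Cmap C w) = w := by
  ext i
  simp [Dg, Cmap_apply, h]

set_option maxHeartbeats 1000000 in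
lemma L4 {n : ℕ} (B : MvPolynomial (Fin n) ℝ) (hne : ∃ z, eval z B = 0) :
    ∃ (c : ℕ) (g : Fin c → MvPolynomial (Fin n) ℝ) (z0 : Fin n → ℝ) (C : Fin c → Fin n → ℝ),
      eval z0 B = 0 ∧ (∀ i z, eval z B = 0 → eval z (g i) = 0) ∧
      (∀ i j, dP (g i) z0 (C j) = if i = j then 1 else 0) ∧
      ∀ᶠ y in nhds z0, (∀ i, eval y (g i) = 0) → eval y B = 0 := by
  classical
  obtain ⟨c, g, z0, C, hz0, hg, hC, hmax⟩ := L4_max B hne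
  refine ⟨c, g, z0, C, hz0, hg, hC, ?_⟩
  obtain ⟨s, r, hs1, hs2, hest⟩ := L4_est B g C hg hmax
  have hLC := Dg_Cmap g z0 C hC
  let L := Dg g z0
  let Cc := Cmap C
  let Φ : (Fin n → ℝ) → (Fin n → ℝ) := fun y => (y - z0) + Cc (gvec g y - L (y - z0))
  let Φ' : (Fin n → ℝ) → ((Fin n → ℝ) →L[ℝ] (Fin n → ℝ)) := fun y => 1 + Cc.comp (Dg g y - L)
  have hΦ : ∀ y, HasStrictFDerivAt Φ (Φ' y) y := by
    intro y
    have h1 : HasStrictFDerivAt (fun y : Fin n → ℝ => y - z0) (1 : (Fin n → ℝ) →L[ℝ] (Fin n → ℝ)) y :=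
      (hasStrictFDerivAt_id y).sub_const z0
    have h2 : HasStrictFDerivAt (fun y => L (y - z0)) L y := by
      exact L.hasStrictFDerivAt.comp y h1
    exact h1.add (Cc.hasStrictFDerivAt.comp y ((gvec_strict g y).sub h2))
  have hΦ'0 : Φ' z0 = 1 := by ext; simp [Φ', L]
  have hLΦ : ∀ y, L (Φ y) = gvec g y := by
    intro y
    have : L (Cc (gvec g y - L (y - z0))) = gvec g y - L (y - z0) := hLC _
    simp only [Φ]
    rw [map_add, this]; abel
  have hLΦ' : ∀ y e, L (Φ' y e) = Dg g y e := by
    intro y e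
    have : L (Cc ((Dg g y - L) e)) = (Dg g y - L) e := hLC _
    simp only [Φ']
    rw [add_apply, map_add, ContinuousLinearMap.comp_apply, this]
    simp
  have hΦ'c : Continuous Φ' := by
    refine continuous_const.add ?_
    exact (ContinuousLinearMap.compL ℝ _ _ _ Cc).continuous.comp ((Dg_cont g).sub continuous_const)
  have hst : HasStrictFDerivAt Φ ((ContinuousLinearEquiv.refl ℝ (Fin n → ℝ) : (Fin n → ℝ) ≃L[ℝ] (Fin n → ℝ)) : (Fin n → ℝ) →L[ℝ] (Fin n → ℝ)) z0 := by
    have := hΦ z0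
    rw [hΦ'0] at this
    exact this
  let ph := hst.toOpenPartialHomeomorph Φ
  have hph : ∀ y, ph y = Φ y := fun y => rfl
  have hsrc : z0 ∈ ph.source := hst.mem_toOpenPartialHomeomorph_source
  have hΦ0 : Φ z0 = 0 := by
    have : gvec g z0 = 0 := funext fun i => hg i z0 hz0
    simp [Φ, this]
  let M : (Fin n → ℝ) → ℝ := fun y => (Matrix.of fun i j => dP (g i) y (C j)).det
  have hM0 : M z0 = 1 := by
    have : (Matrix.of fun i j => dP (g i) z0 (C j)) = 1 := by
      ext i j; simp [hC, Matrix.one_apply]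
    simp only [M, this, Matrix.det_one]
  have hMc : Continuous M := by
    refine Continuous.matrix_det ?_
    refine continuous_pi fun i => continuous_pi fun j => ?_
    simp only [Matrix.of_apply, dP_apply]
    exact continuous_finsetSum _ fun k _ => (cont_eval _).mul continuous_const
  have hN : ∀ᶠ y in nhds z0, ‖1 - Φ' y‖ < 1/2 ∧ 1/2 < M y ∧ y ∈ Metric.closedBall z0 1 ∧ y ∈ ph.source := by
    refine Filter.Eventually.and ?_ (Filter.Eventually.and ?_ (Filter.Eventually.and ?_ ?_))
    · have : Continuous fun y => ‖1 - Φ' y‖ := (continuous_const.sub hΦ'c).norm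
      refine this.continuousAt.eventually_lt continuousAt_const ?_
      simp [hΦ'0]
    · exact continuousAt_const.eventually_lt hMc.continuousAt (by rw [hM0]; norm_num)
    · exact Metric.closedBall_mem_nhds _ one_pos
    · exact ph.open_source.mem_nhds hsrc
  have h0t : (0 : Fin n → ℝ) ∈ ph.target := by
    rw [← hΦ0]; exact ph.map_source hsrc
  have hsymm0 : ph.symm 0 = z0 := by
    have := ph.left_inv hsrc
    rwa [hph, hΦ0] at this
  have hN2 : ∀ᶠ x in nhds (0 : Fin n → ℝ), x ∈ ph.target ∧ (‖1 - Φ' (ph.symm x)‖ < 1/2 ∧ 1/2 < M (ph.symm x) ∧ (ph.symm x) ∈ Metric.closedBall z0 1 ∧ (ph.symm x) ∈ ph.source) := by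
    refine Filter.Eventually.and (ph.open_target.mem_nhds h0t) ?_
    have h1 := ph.symm.continuousAt (x := 0) h0t
    have h2 : Filter.Tendsto ph.symm (nhds 0) (nhds z0) := by
      rw [ContinuousAt, hsymm0] at h1; exact h1
    exact h2.eventually hN
  obtain ⟨ρ, hρ, hball⟩ := Metric.eventually_nhds_iff.1 hN2
  have hnear : ∀ᶠ y in nhds z0, y ∈ ph.source ∧ ‖Φ y‖ < ρ := by
    refine Filter.Eventually.and (ph.open_source.mem_nhds hsrc) ?_
    have : ContinuousAt (fun y => ‖Φ y‖) z0 := (hΦ z0).continuousAt.norm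
    refine this.eventually_lt continuousAt_const ?_
    simp [hΦ0, hρ]
  obtain ⟨R, hR⟩ : ∃ R, ∀ y ∈ Metric.closedBall z0 1, ∀ h l h', |eval y (r h l h')| ≤ R := by
    have hc : Continuous fun y => ∑ h, ∑ l, ∑ h', |eval y (r h l h')| :=
      continuous_finsetSum _ fun h _ => continuous_finsetSum _ fun l _ => continuous_finsetSum _ fun h' _ => (cont_eval _).abs
    obtain ⟨R, hR⟩ := (isCompact_closedBall z0 1).bddAbove_image hc.continuousOn
    refine ⟨R, fun y hy h l h' => le_trans ?_ (hR ⟨y, hy, rfl⟩)⟩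
    refine le_trans ?_ (Finset.single_le_sum (f := fun h => ∑ l, ∑ h', |eval y (r h l h')|) (fun _ _ => by positivity) (Finset.mem_univ h))
    refine le_trans ?_ (Finset.single_le_sum (f := fun l => ∑ h', |eval y (r h l h')|) (fun _ _ => by positivity) (Finset.mem_univ l))
    exact (Finset.single_le_sum (f := fun h' => |eval y (r h l h')|) (fun _ _ => by positivity) (Finset.mem_univ h'))
  filter_upwards [hnear] with y hy hgy
  set x := Φ y with hx
  have hLx : L x = 0 := by
    rw [hx, hLΦ]; exact funext hgy
  have hτ : ∀ τ ∈ Set.Icc (0:ℝ) 1, dist (τ • x) 0 < ρ := by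
    intro τ hτ
    rw [dist_zero_right, norm_smul, Real.norm_of_nonneg hτ.1]
    exact lt_of_le_of_lt (mul_le_of_le_one_left (norm_nonneg _) hτ.2) hy.2
  let γ : ℝ → (Fin n → ℝ) := fun τ => ph.symm (τ • x)
  have hγ : ∀ τ ∈ Set.Icc (0:ℝ) 1, ∃ d : Fin n → ℝ, HasDerivAt γ d τ ∧ ‖d‖ ≤ 2 * ‖x‖ ∧ ∀ i, dP (g i) (γ τ) d = 0 := by
    intro τ hτm
    obtain ⟨ht, hn1, -, -, -⟩ := hball (hτ τ hτm)
    let u := Units.oneSub (1 - Φ' (γ τ)) (lt_trans hn1 (by norm_num))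
    have hu : ((ContinuousLinearEquiv.ofUnit u : (Fin n → ℝ) ≃L[ℝ] (Fin n → ℝ)) : (Fin n → ℝ) →L[ℝ] (Fin n → ℝ)) = Φ' (γ τ) := by
      ext1 e
      change (1 - (1 - Φ' (γ τ))) e = _
      simp
    have h1 : HasFDerivAt ph ((ContinuousLinearEquiv.ofUnit u : (Fin n → ℝ) ≃L[ℝ] (Fin n → ℝ)) : (Fin n → ℝ) →L[ℝ] (Fin n → ℝ)) (ph.symm (τ • x)) := by
      rw [hu]; exact (hΦ _).hasFDerivAt
    have h2 := ph.hasFDerivAt_symm ht h1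
    have h3 : HasDerivAt (fun τ : ℝ => τ • x) x τ := by simpa using (hasDerivAt_id τ).smul_const x
    have h4 := h2.comp_hasDerivAt τ h3
    set d := (ContinuousLinearEquiv.ofUnit u).symm x with hd
    have h5 : Φ' (γ τ) d = x := by
      rw [← hu]; simp [hd]
    refine ⟨d, h4, ?_, ?_⟩
    · have h6 : d = x + (1 - Φ' (γ τ)) d := by rw [sub_apply, h5]; simp
      have h7 : ‖(1 - Φ' (γ τ)) d‖ ≤ 1/2 * ‖d‖ := (ContinuousLinearMap.le_opNorm _ _).trans (by gcongr)
      have h8 : ‖d‖ ≤ ‖x‖ + ‖(1 - Φ' (γ τ)) d‖ := by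
        calc ‖d‖ = ‖x + (1 - Φ' (γ τ)) d‖ := by rw [← h6]
          _ ≤ _ := norm_add_le _ _
      linarith
    · intro i
      have := hLΦ' (γ τ) d
      rw [h5, hLx] at this
      exact (congrFun this i).symm
  choose! γ' hγ1 hγ2 hγ3 using hγ
  let u : ℝ → (s → ℝ) := fun τ h => eval (γ τ) h.1
  have hu' : ∀ τ ∈ Set.Icc (0:ℝ) 1, HasDerivAt u (fun h : s => dP h.1 (γ τ) (γ' τ)) τ := by
    intro τ hτm
    rw [hasDerivAt_pi]
    intro h
    exact (hasStrict_eval h.1 (γ τ)).hasFDerivAt.comp_hasDerivAt τ (hγ1 τ hτm)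
  have hu0 : u 0 = 0 := by
    funext h
    simp only [u, γ, zero_smul, hsymm0]
    exact hs1 h.1 h.2 z0 hz0
  have hfin := eq_zero_of_abs_deriv_le_mul_abs_self_of_eq_zero_right (f := u) (f' := fun τ (h : s) => dP h.1 (γ τ) (γ' τ))
    (K := 2 * ∑ l : Fin n, (2 * ‖x‖) * ∑ h' : s, |R|) (a := 0) (b := 1)
    (fun τ hτm => (hu' τ hτm).continuousAt.continuousWithinAt)
    (fun τ hτm => (hu' τ ⟨hτm.1, hτm.2.le⟩).hasDerivWithinAt) hu0 (by
      intro τ hτm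
      have hτm' : τ ∈ Set.Icc (0:ℝ) 1 := ⟨hτm.1, hτm.2.le⟩
      obtain ⟨ht, -, hM, hcb, -⟩ := hball (hτ τ hτm')
      have hnn : 0 ≤ (2 * ∑ l : Fin n, (2 * ‖x‖) * ∑ h' : s, |R|) * ‖u τ‖ := by positivity
      rw [pi_norm_le_iff_of_nonneg hnn]
      intro h
      have h1 := hest h (γ τ) (γ' τ) (hγ3 τ hτm')
      have h2 : |M (γ τ) * dP h.1 (γ τ) (γ' τ)| ≤ (∑ l : Fin n, (2 * ‖x‖) * ∑ h' : s, |R|) * ‖u τ‖ := by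
        change |(Matrix.of fun i j => dP (g i) (γ τ) (C j)).det * _| ≤ _
        rw [h1, Finset.sum_mul]
        refine (Finset.abs_sum_le_sum_abs _ _).trans (Finset.sum_le_sum fun l _ => ?_)
        rw [abs_mul, mul_assoc]
        refine mul_le_mul ((norm_le_pi_norm (γ' τ) l).trans (hγ2 τ hτm')) ?_ (abs_nonneg _) (by positivity)
        rw [Finset.sum_mul]
        refine (Finset.abs_sum_le_sum_abs _ _).trans (Finset.sum_le_sum fun h' _ => ?_)
        rw [abs_mul]
        exact mul_le_mul ((hR _ hcb h l h').trans (le_abs_self R)) (norm_le_pi_norm (u τ) h') (abs_nonneg _) (abs_nonneg _)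
      rw [abs_mul, abs_of_pos (lt_trans (by norm_num) hM)] at h2
      rw [Real.norm_eq_abs]
      have h3 : 1/2 * |dP h.1 (γ τ) (γ' τ)| ≤ M (γ τ) * |dP h.1 (γ τ) (γ' τ)| := by gcongr
      linarith)
  have hu1 := hfin 1 ⟨zero_le_one, le_rfl⟩
  have hγ1y : γ 1 = y := by
    simp only [γ, one_smul, hx]
    exact ph.left_inv hy.1
  apply hs2
  intro h hh
  have := congrFun hu1 ⟨h, hh⟩
  simpa [u, hγ1y] using this

end Part8

section Part9
open MvPolynomial

lemma SW {m : ℕ} (K : Set (Fin m → ℝ)) (hK : IsCompact K) (h : (Fin m → ℝ) → ℝ) (hh : ContinuousOn h K)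
    (ε : ℝ) (hε : 0 < ε) : ∃ H : MvPolynomial (Fin m) ℝ, ∀ x ∈ K, |eval x H - h x| < ε := by
  have : CompactSpace K := isCompact_iff_compactSpace.1 hK
  let co : Fin m → C(K, ℝ) := fun i => ⟨fun x => x.1 i, (continuous_apply i).comp continuous_subtype_val⟩
  let φ : MvPolynomial (Fin m) ℝ →ₐ[ℝ] C(K, ℝ) := aeval co
  have hφ : ∀ p (x : K), φ p x = eval x.1 p := by
    intro p x
    induction p using MvPolynomial.induction_on with
    | C a => simp [φ]
    | add p q hp hq => simp [hp, hq]
    | mul_X p i hp => rw [map_mul, ContinuousMap.mul_apply, hp]; simp [φ, co]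
  obtain ⟨⟨H, p, rfl⟩, hH⟩ := ContinuousMap.exists_mem_subalgebra_near_continuous_of_separatesPoints φ.range (by
    intro x y hxy
    have : x.1 ≠ y.1 := fun h => hxy (Subtype.ext h)
    obtain ⟨i, hi⟩ := Function.ne_iff.1 this
    refine ⟨co i, ⟨co i, ⟨X i, by simp [φ]⟩, rfl⟩, hi⟩) (K.domRestrict h) (ContinuousOn.domRestrict hh) ε hε
  refine ⟨p, fun x hx => ?_⟩
  have := hH ⟨x, hx⟩
  simp only [Real.norm_eq_abs] at this
  rw [← hφ p ⟨x, hx⟩]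
  exact this

noncomputable def sphP (c : ℕ) : MvPolynomial (Fin (c+1)) ℝ :=
  ∑ j : Fin c, X (Fin.castSucc j) ^ 2 + X (Fin.last c) ^ 2 - C 2 * X (Fin.last c)

lemma sph_eval {c : ℕ} (x : Fin (c+1) → ℝ) : eval x (sphP c) =
    ∑ j : Fin c, x (Fin.castSucc j) ^ 2 + x (Fin.last c) ^ 2 - 2 * x (Fin.last c) := by
  simp [sphP]

noncomputable def fP {n c : ℕ} (z0 : Fin n → ℝ) (C' : Fin c → Fin n → ℝ) (η : ℝ)
    (H : Fin n → MvPolynomial (Fin (c+1)) ℝ) (i : Fin n) : MvPolynomial (Fin (c+1)) ℝ :=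
  C (z0 i) + ∑ j, C (η * C' j i) * X (Fin.castSucc j) + X (Fin.last c) ^ 2 * H i

lemma fP_eval {n c : ℕ} (z0 : Fin n → ℝ) (C' : Fin c → Fin n → ℝ) (η : ℝ)
    (H : Fin n → MvPolynomial (Fin (c+1)) ℝ) (x) :
    (fun i => eval x (fP z0 C' η H i)) = z0 + η • Cmap C' (fun j => x (Fin.castSucc j)) +
      (x (Fin.last c)) ^ 2 • (fun i => eval x (H i)) := by
  ext i
  simp [fP, Cmap_apply, Finset.mul_sum, mul_assoc]
  refine Finset.sum_congr rfl fun j _ => by ring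

set_option maxHeartbeats 1000000 in
lemma LA {n c : ℕ} (B : MvPolynomial (Fin n) ℝ) (F G : (Fin n → ℝ) → (Fin n → ℝ)) (hF : Continuous F)
    (hFU : ∀ x, eval (F x) B ≠ 0) (hG : ContinuousOn G {y | eval y B ≠ 0})
    (hFG : ∀ y, eval y B ≠ 0 → F (G y) = y)
    (g : Fin c → MvPolynomial (Fin n) ℝ) (z0 : Fin n → ℝ) (C : Fin c → Fin n → ℝ)
    (hz0 : eval z0 B = 0) (hg : ∀ i z, eval z B = 0 → eval z (g i) = 0)
    (hC : ∀ i j, dP (g i) z0 (C j) = if i = j then 1 else 0) :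
    ∃ (η : ℝ) (H : Fin n → MvPolynomial (Fin (c+1)) ℝ), 0 < η ∧
      ∀ x, eval x (sphP c) = 0 → x ≠ 0 → eval (fun i => eval x (fP z0 C η H i)) B ≠ 0 := by
  classical
  have hLC := Dg_Cmap g z0 C hC
  let L := Dg g z0
  let Cc := Cmap C
  have hg0 : gvec g z0 = 0 := funext fun i => hg i z0 hz0
  have hgZ : ∀ y, gvec g y ≠ 0 → eval y B ≠ 0 := fun y hy hB => hy (funext fun i => hg i y hB)
  let κ : ℝ := 1 / (4 * (‖Cc‖ + 1))
  have hκ : 0 < κ := by positivity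
  have hκC : κ * ‖Cc‖ ≤ 1/4 := by
    simp only [κ]
    rw [div_mul_eq_mul_div, div_le_iff₀ (by positivity)]
    linarith [norm_nonneg Cc]
  obtain ⟨r, hr, hgr⟩ : ∃ r > 0, ∀ δ : Fin n → ℝ, ‖δ‖ ≤ r → ‖gvec g (z0 + δ) - L δ‖ ≤ κ * ‖δ‖ := by
    have h1 := (gvec_strict g z0).hasFDerivAt
    rw [hasFDerivAt_iff_isLittleO_nhds_zero] at h1
    have h2 := (Asymptotics.isLittleO_iff.1 h1) hκ
    obtain ⟨r, hr, h3⟩ := Metric.eventually_nhds_iff.1 h2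
    refine ⟨r/2, by positivity, fun δ hδ => ?_⟩
    have := h3 (y := δ) (by rw [dist_zero_right]; linarith)
    rwa [hg0, sub_zero] at this
  let η : ℝ := r / (2 * (‖Cc‖ + 1))
  have hη : 0 < η := by positivity
  have hηC : η * ‖Cc‖ ≤ r/2 := by
    simp only [η]
    rw [div_mul_eq_mul_div, div_le_iff₀ (by positivity)]
    nlinarith [norm_nonneg Cc]
  let W : (Fin (c+1) → ℝ) → (Fin c → ℝ) := fun x j => x (Fin.castSucc j)
  let U : (Fin (c+1) → ℝ) → ℝ := fun x => x (Fin.last c)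
  have hWc : Continuous W := by fun_prop
  have hUc : Continuous U := by fun_prop
  let Y : (Fin (c+1) → ℝ) → (Fin n → ℝ) := fun x => z0 + η • Cc (W x)
  have hYc : Continuous Y := by fun_prop
  -- main estimate
  have hest : ∀ (w : Fin c → ℝ) (e : Fin n → ℝ) (t : ℝ), 0 ≤ t → w ≠ 0 → ‖w‖ ≤ 1 → ‖e‖ ≤ t * ‖w‖ → t ≤ r/2 →
      (κ + ‖L‖) * t < η/2 → eval (z0 + η • Cc w + e) B ≠ 0 := by
    intro w e t ht0 hw hw1 he ht ht2
    apply hgZ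
    intro h0
    have hwp : 0 < ‖w‖ := norm_pos_iff.2 hw
    set δ := η • Cc w + e with hδ
    have hδn : ‖δ‖ ≤ (η * ‖Cc‖ + t) * ‖w‖ := by
      calc ‖δ‖ ≤ ‖η • Cc w‖ + ‖e‖ := norm_add_le _ _
        _ ≤ η * (‖Cc‖ * ‖w‖) + t * ‖w‖ := by
          rw [norm_smul, Real.norm_of_nonneg hη.le]
          gcongr
          exact Cc.le_opNorm w
        _ = _ := by ring
    have hδr : ‖δ‖ ≤ r := by
      refine hδn.trans ?_
      calc (η * ‖Cc‖ + t) * ‖w‖ ≤ (r/2 + r/2) * 1 := by gcongr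
        _ = r := by ring
    have h1 := hgr δ hδr
    rw [show z0 + δ = z0 + η • Cc w + e by rw [hδ, add_assoc], h0, zero_sub, norm_neg] at h1
    have h2 : L δ = η • w + L e := by
      rw [hδ, map_add, map_smul]
      congr 2
      exact hLC w
    have h3 : η * ‖w‖ ≤ ‖L δ‖ + ‖L e‖ := by
      have : η • w = L δ - L e := by rw [h2]; abel
      rw [← Real.norm_of_nonneg hη.le, ← norm_smul, this]
      exact norm_sub_le _ _
    have h4 : ‖L e‖ ≤ ‖L‖ * (t * ‖w‖) := (L.le_opNorm e).trans (by gcongr)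
    have h5 : κ * ‖δ‖ ≤ κ * ((η * ‖Cc‖ + t) * ‖w‖) := by gcongr
    have h6 : κ * ((η * ‖Cc‖ + t) * ‖w‖) = (κ * ‖Cc‖) * (η * ‖w‖) + κ * t * ‖w‖ := by ring
    have h7 : (κ * ‖Cc‖) * (η * ‖w‖) ≤ 1/4 * (η * ‖w‖) := by gcongr
    have h8 : (κ + ‖L‖) * t * ‖w‖ < η/2 * ‖w‖ := by gcongr
    have h9 : 0 < η * ‖w‖ := by positivity
    nlinarith
  -- sphere
  let S : Set (Fin (c+1) → ℝ) := {x | eval x (sphP c) = 0}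
  have hSc : IsClosed S := isClosed_eq (cont_eval _) continuous_const
  have hSW : ∀ x ∈ S, ∑ j, W x j ^ 2 = U x * (2 - U x) := by
    intro x hx
    have h1 : eval x (sphP c) = 0 := hx
    rw [sph_eval] at h1
    simp only [W, U]; linarith
  have hSU : ∀ x ∈ S, 0 ≤ U x ∧ U x ≤ 2 := by
    intro x hx
    have h1 := hSW x hx
    have h2 : 0 ≤ ∑ j, W x j ^ 2 := by positivity
    constructor <;> nlinarith
  have hWj : ∀ x (j : Fin c), W x j ^ 2 ≤ ∑ j, W x j ^ 2 := fun x j =>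
    Finset.single_le_sum (f := fun j => W x j ^ 2) (fun _ _ => sq_nonneg _) (Finset.mem_univ j)
  have hS1 : ∀ x ∈ S, ‖W x‖ ≤ 1 := by
    intro x hx
    rw [pi_norm_le_iff_of_nonneg zero_le_one]
    intro j
    rw [Real.norm_eq_abs, ← sq_le_one_iff_abs_le_one]
    have h1 := hSW x hx
    have h2 := hWj x j
    nlinarith [sq_nonneg (U x - 1)]
  have hScomp : IsCompact S := by
    refine Metric.isCompact_of_isClosed_isBounded hSc ?_
    refine (Metric.isBounded_closedBall (x := (0 : Fin (c+1) → ℝ)) (r := 2)).subset fun x hx => ?_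
    rw [mem_closedBall_zero_iff, pi_norm_le_iff_of_nonneg (by norm_num)]
    intro i
    refine Fin.lastCases ?_ (fun j => ?_) i
    · rw [Real.norm_eq_abs, abs_le]; have := hSU x hx; simp only [U] at this; constructor <;> linarith
    · exact ((norm_le_pi_norm (W x) j).trans (hS1 x hx)).trans (by norm_num)
  have hW0 : ∀ x ∈ S, W x = 0 → U x = 0 ∨ U x = 2 := by
    intro x hx hw
    have h1 := hSW x hx
    rw [hw] at h1
    simp at h1
    rcases h1 with h | h
    · exact Or.inl h
    · right; linarith
  have hx0 : ∀ x, W x = 0 → U x = 0 → x = 0 := by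
    intro x h1 h2
    funext i
    refine Fin.lastCases ?_ (fun j => ?_) i
    · exact h2
    · exact congrFun h1 j
  have hYB : ∀ x ∈ S, W x ≠ 0 → eval (Y x) B ≠ 0 := by
    intro x hx hw
    have := hest (W x) 0 0 le_rfl hw (hS1 x hx) (by simp) (by positivity) (by simpa using hη)
    simpa [Y] using this
  have hWU : ∀ x ∈ S, U x ≤ 1 → U x ^ 2 ≤ c * ‖W x‖ := by
    intro x hx h1
    have h2 := hSW x hx
    have h3 := hSU x hx
    have h4 : ∑ j, W x j ^ 2 ≤ ∑ j : Fin c, ‖W x‖ := by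
      refine Finset.sum_le_sum fun j _ => ?_
      have h5 := norm_le_pi_norm (W x) j
      have h6 := hS1 x hx
      rw [Real.norm_eq_abs] at h5
      rw [← sq_abs]
      nlinarith [abs_nonneg (W x j)]
    simp at h4
    nlinarith
  let lam : ℝ → ℝ := fun u => min 1 (max 0 (3 - 2 * u))
  have hlamc : Continuous lam := by fun_prop
  let Kf : (Fin (c+1) → ℝ) → (Fin n → ℝ) := fun x => F (lam (U x) • G (Y x))
  have hopen : IsOpen {y : Fin n → ℝ | eval y B ≠ 0} := isOpen_ne_fun (cont_eval _) continuous_const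
  have hKc : ∀ x ∈ S, x ≠ 0 → ContinuousAt Kf x := by
    intro x hx hxne
    refine hF.continuousAt.comp ?_
    by_cases hw : W x = 0
    · have hu : U x = 2 := by
        rcases hW0 x hx hw with h | h
        · exact absurd (hx0 x hw h) hxne
        · exact h
      have hev : ∀ᶠ x' in nhds x, (0 : Fin n → ℝ) = lam (U x') • G (Y x') := by
        have : ∀ᶠ x' in nhds x, 3/2 < U x' := continuousAt_const.eventually_lt hUc.continuousAt (by rw [hu]; norm_num)
        filter_upwards [this] with x' hx'
        have : lam (U x') = 0 := by
          simp only [lam]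
          rw [max_eq_left (by linarith)]; simp
        rw [this, zero_smul]
      exact (continuousAt_const (y := (0 : Fin n → ℝ))).congr hev
    · have h1 : ContinuousAt G (Y x) := hG.continuousAt (hopen.mem_nhds (hYB x hx hw))
      exact (hlamc.comp hUc).continuousAt.smul (ContinuousAt.comp h1 hYc.continuousAt)
  let h1 : (Fin (c+1) → ℝ) → (Fin n → ℝ) := fun x => (U x ^ 2)⁻¹ • (Kf x - Y x)
  have hK1 : ∀ x ∈ S, U x ≤ 1 → W x ≠ 0 → Kf x = Y x := by
    intro x hx hu hw
    have : lam (U x) = 1 := by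
      simp only [lam]
      rw [min_eq_left]
      exact le_max_of_le_right (by linarith)
    simp only [Kf, this, one_smul]
    exact hFG _ (hYB x hx hw)
  have hh1 : ∀ x ∈ S, U x ≤ 1 → h1 x = 0 := by
    intro x hx hu
    by_cases hw : W x = 0
    · rcases hW0 x hx hw with h | h
      · simp [h1, h]
      · linarith
    · simp [h1, hK1 x hx hu hw]
  have hh1c : ContinuousOn h1 S := by
    intro x hx
    by_cases hx0' : x = 0
    · have : ∀ᶠ x' in nhdsWithin x S, h1 x' = 0 := by
        have h2 : ∀ᶠ x' in nhds x, U x' < 1 := hUc.continuousAt.eventually_lt continuousAt_const (by simp [U, hx0'])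
        filter_upwards [nhdsWithin_le_nhds h2, self_mem_nhdsWithin] with x' h3 h4
        exact hh1 x' h4 h3.le
      refine (continuousWithinAt_const (b := (0 : Fin n → ℝ))).congr_of_eventuallyEq this ?_
      exact hh1 x hx (by simp [U, hx0'])
    · have hu : U x ≠ 0 := by
        intro h
        apply hx0'
        apply hx0 x _ h
        have h2 := hSW x hx
        rw [h, zero_mul] at h2
        funext j
        have := hWj x j
        rw [h2] at this
        exact pow_eq_zero_iff (two_ne_zero) |>.1 (le_antisymm this (sq_nonneg _))
      refine ContinuousAt.continuousWithinAt ?_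
      exact ((hUc.continuousAt.pow 2).inv₀ (pow_ne_zero 2 hu)).smul ((hKc x hx hx0').sub hYc.continuousAt)
  -- compact part
  have hS2 : IsCompact (S ∩ {x | 1 ≤ U x}) := hScomp.inter_right (isClosed_le continuous_const hUc)
  have hne0 : ∀ x, 1 ≤ U x → x ≠ 0 := by
    rintro x h rfl
    simp [U] at h
    linarith
  have hKim : IsCompact (Kf '' (S ∩ {x | 1 ≤ U x})) :=
    hS2.image_of_continuousOn fun x hx => (hKc x hx.1 (hne0 x hx.2)).continuousWithinAt
  obtain ⟨ε1, hε1, hthick⟩ := hKim.exists_thickening_subset_open hopen (by rintro _ ⟨x, _, rfl⟩; exact hFU _)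
  obtain ⟨ε, hε, he1, he2, he3⟩ : ∃ ε > 0, 4 * ε < ε1 ∧ ε * c ≤ r/2 ∧ (κ + ‖L‖) * (ε * c) < η/2 := by
    have hev : ∀ᶠ ε in nhds (0:ℝ), 4 * ε < ε1 ∧ ε * c < r/2 ∧ (κ + ‖L‖) * (ε * c) < η/2 := by
      refine Filter.Eventually.and ?_ (Filter.Eventually.and ?_ ?_)
      · exact ContinuousAt.eventually_lt (by fun_prop) continuousAt_const (by simpa using hε1)
      · exact ContinuousAt.eventually_lt (by fun_prop) continuousAt_const (by simpa using hr)
      · exact ContinuousAt.eventually_lt (by fun_prop) continuousAt_const (by simpa using hη)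
    obtain ⟨ρ, hρ, hb⟩ := Metric.eventually_nhds_iff.1 hev
    have := hb (y := ρ/2) (by rw [dist_zero_right, Real.norm_of_nonneg (by positivity)]; linarith)
    exact ⟨ρ/2, by positivity, this.1, this.2.1.le, this.2.2⟩
  have hSWi : ∀ i, ∃ Hi : MvPolynomial (Fin (c+1)) ℝ, ∀ x ∈ S, |eval x Hi - h1 x i| < ε := fun i =>
    SW S hScomp (fun x => h1 x i) (continuousOn_pi.1 hh1c i) ε hε
  choose H hH using hSWi
  refine ⟨η, H, hη, fun x hx hxne => ?_⟩
  have hxS : x ∈ S := hx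
  have hHn : ‖(fun i => eval x (H i)) - h1 x‖ ≤ ε := by
    rw [pi_norm_le_iff_of_nonneg hε.le]
    intro i
    exact (hH i x hxS).le
  rw [fP_eval]
  change eval (Y x + U x ^ 2 • _) B ≠ 0
  rcases le_or_gt 1 (U x) with hu | hu
  · apply hthick
    rw [Metric.mem_thickening_iff]
    refine ⟨Kf x, ⟨x, ⟨hxS, hu⟩, rfl⟩, ?_⟩
    have hk : Kf x = Y x + U x ^ 2 • h1 x := by
      have : U x ^ 2 ≠ 0 := by positivity
      simp only [h1]
      rw [smul_smul, mul_inv_cancel₀ this, one_smul]; abel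
    rw [hk, dist_add_left, dist_eq_norm, ← smul_sub, norm_smul, Real.norm_of_nonneg (sq_nonneg _)]
    have h3 := hSU x hxS
    calc U x ^ 2 * ‖(fun i => eval x (H i)) - h1 x‖ ≤ 4 * ε := by
          gcongr; nlinarith
      _ < ε1 := he1
  · have hw : W x ≠ 0 := by
      intro h
      rcases hW0 x hxS h with h' | h'
      · exact hxne (hx0 x h h')
      · linarith
    rw [hh1 x hxS hu.le, sub_zero] at hHn
    refine hest (W x) _ (ε * c) (by positivity) hw (hS1 x hxS) ?_ he2 he3
    rw [norm_smul, Real.norm_of_nonneg (sq_nonneg _)]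
    calc U x ^ 2 * ‖(fun i => eval x (H i))‖ ≤ (c * ‖W x‖) * ε := by
          gcongr; exact hWU x hxS hu.le
      _ = _ := by ring

end Part9

section Part10
open MvPolynomial

lemma dense_ne {n : ℕ} (δ : MvPolynomial (Fin n) ℝ) (hδ : δ ≠ 0) (a : Fin n → ℝ) (P : (Fin n → ℝ) → Prop)
    (hP : ∀ᶠ v in nhds a, P v) : ∃ v, P v ∧ eval v δ ≠ 0 := by
  by_contra! hh
  have h1 : ∀ᶠ v in nhds a, eval v δ = 0 := hP.mono hh
  apply hδ
  have h2 : AnalyticOnNhd ℝ (fun v => eval v δ) Set.univ := AnalyticOnNhd.eval_mvPolynomial δ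
  have h3 := h2.eqOn_zero_of_preconnected_of_eventuallyEq_zero isPreconnected_univ (Set.mem_univ a) h1
  exact MvPolynomial.funext fun x => by rw [map_zero]; exact h3 (Set.mem_univ x)

lemma evVW_cont {n m : ℕ} (p : MvPolynomial (Fin m) (MvPolynomial (Fin n) ℝ)) :
    Continuous fun q : (Fin m → ℝ) × (Fin n → ℝ) => evVW q.2 q.1 p := by
  induction p using MvPolynomial.induction_on with
  | C a => simp; exact (cont_eval a).comp continuous_snd
  | add p q hp hq => simp only [map_add]; exact hp.add hq
  | mul_X p i hp =>
    simp only [map_mul]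
    refine hp.mul ?_
    simp
    fun_prop

noncomputable def subP {n m : ℕ} (f : Fin n → MvPolynomial (Fin m) ℝ) :
    MvPolynomial (Fin n) ℝ →ₐ[ℝ] MvPolynomial (Fin m) (MvPolynomial (Fin n) ℝ) :=
  aeval (fun i => map C (f i) - C (X i))

lemma evVW_map {n m : ℕ} (v : Fin n → ℝ) (x : Fin m → ℝ) (p : MvPolynomial (Fin m) ℝ) :
    evVW v x (map C p) = eval x p := by
  simp only [coe_eval₂Hom, eval₂_map]
  have : (eval v).comp C = RingHom.id ℝ := by ext; simp
  rw [this]; rfl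

lemma evVW_sub {n m : ℕ} (f : Fin n → MvPolynomial (Fin m) ℝ) (v : Fin n → ℝ) (x : Fin m → ℝ) (h : MvPolynomial (Fin n) ℝ) :
    evVW v x (subP f h) = eval ((fun i => eval x (f i)) - v) h := by
  have : (evVW v x).comp (subP f).toRingHom = eval ((fun i => eval x (f i)) - v) := by
    apply MvPolynomial.ringHom_ext
    · intro r; simp [subP, MvPolynomial.algebraMap_apply]
    · intro i
      have := evVW_map v x (f i)
      simp only [coe_eval₂Hom] at this
      simp [subP, this]
  exact RingHom.congr_fun this h

lemma evVW_pderiv_sub {n m : ℕ} (f : Fin n → MvPolynomial (Fin m) ℝ) (v : Fin n → ℝ) (x : Fin m → ℝ) (h : MvPolynomial (Fin n) ℝ) (j : Fin m) :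
    evVW v x (pderiv j (subP f h)) = ∑ k, eval ((fun i => eval x (f i)) - v) (pderiv k h) * eval x (pderiv j (f k)) := by
  induction h using MvPolynomial.induction_on with
  | C a => simp [subP, MvPolynomial.algebraMap_apply]
  | add p q hp hq => simp only [map_add, hp, hq, add_mul, Finset.sum_add_distrib]
  | mul_X p i hp =>
    have hX : subP f (X i) = map C (f i) - C (X i) := by simp [subP]
    rw [map_mul, Derivation.leibniz, map_add, smul_eq_mul, smul_eq_mul, map_mul, map_mul, hp, evVW_sub]
    have h1 : evVW v x (pderiv j (subP f (X i))) = eval x (pderiv j (f i)) := by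
      rw [hX, map_sub, pderiv_C, sub_zero, pderiv_map, evVW_map]
    have h2 := evVW_sub f v x (X i)
    rw [h1, h2]
    simp only [Derivation.leibniz, smul_eq_mul, pderiv_X, map_add, map_mul, eval_X, add_mul,
        Finset.sum_add_distrib, Finset.mul_sum]
    congr 1
    · rw [Finset.sum_eq_single i]
      · simp
      · intro b _ hb; simp [Pi.single_eq_of_ne hb.symm]
      · simp
    · refine Finset.sum_congr rfl fun k _ => by ring

lemma fP_strict {n c : ℕ} (z0 : Fin n → ℝ) (C' : Fin c → Fin n → ℝ) (η : ℝ)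
    (H : Fin n → MvPolynomial (Fin (c+1)) ℝ) :
    (∀ k j, eval 0 (pderiv (Fin.castSucc j) (fP z0 C' η H k)) = η * C' j k) ∧
    (∀ k, eval 0 (pderiv (Fin.last c) (fP z0 C' η H k)) = 0) := by
  constructor
  · intro k j
    have : ∀ x : Fin c, (Fin.castSucc x = Fin.castSucc j) ↔ x = j := fun x => Fin.castSucc_inj
    simp [fP, pderiv_X, Pi.single_apply, Fin.castSucc_inj]
  · intro k
    have : ∀ x : Fin c, Fin.castSucc x ≠ Fin.last c := fun x => (Fin.castSucc_lt_last x).ne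
    simp [fP, pderiv_X, Pi.single_apply, this]

lemma sph_strict {c : ℕ} :
    (∀ j : Fin c, eval 0 (pderiv (Fin.castSucc j) (sphP c)) = 0) ∧
    (eval 0 (pderiv (Fin.last c) (sphP c)) = -2) := by
  constructor
  · intro j
    have : ∀ x : Fin c, Fin.last c ≠ Fin.castSucc x := fun x => (Fin.castSucc_lt_last x).ne'
    simp [sphP, pderiv_X, Pi.single_apply, this]
  · simp [sphP, pderiv_X, Pi.single_apply]

end Part10

section Part11
open MvPolynomial

lemma evVW_strict {n m : ℕ} (q0 : (Fin n → ℝ) × (Fin m → ℝ)) (P : MvPolynomial (Fin m) (MvPolynomial (Fin n) ℝ)) :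
    ∃ f' : ((Fin n → ℝ) × (Fin m → ℝ)) →L[ℝ] ℝ,
      HasStrictFDerivAt (fun q : (Fin n → ℝ) × (Fin m → ℝ) => evVW q.1 q.2 P) f' q0 ∧
      ∀ w, f' (0, w) = ∑ j, evVW q0.1 q0.2 (pderiv j P) * w j := by
  induction P using MvPolynomial.induction_on with
  | C a =>
    refine ⟨(dP a q0.1).comp (ContinuousLinearMap.fst ℝ _ _), ?_, ?_⟩
    · have := (hasStrict_eval a q0.1).comp q0 (hasStrictFDerivAt_fst (𝕜 := ℝ) (p := q0))
      simpa [Function.comp_def] using this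
    · intro w; simp
  | add p q hp hq =>
    obtain ⟨f1, h1, h1'⟩ := hp
    obtain ⟨f2, h2, h2'⟩ := hq
    refine ⟨f1 + f2, ?_, ?_⟩
    · simp only [map_add]; exact h1.add h2
    · intro w
      rw [add_apply, h1', h2', ← Finset.sum_add_distrib]
      refine Finset.sum_congr rfl fun j _ => ?_
      rw [map_add, map_add, add_mul]
  | mul_X p i hp =>
    obtain ⟨f1, h1, h1'⟩ := hp
    have h2 : HasStrictFDerivAt (fun q : (Fin n → ℝ) × (Fin m → ℝ) => evVW q.1 q.2 (X i))
        ((ContinuousLinearMap.proj (R := ℝ) (φ := fun _ : Fin m => ℝ) i).comp (ContinuousLinearMap.snd ℝ (Fin n → ℝ) (Fin m → ℝ))) q0 := by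
      have := ((ContinuousLinearMap.proj (R := ℝ) (φ := fun _ : Fin m => ℝ) i).comp (ContinuousLinearMap.snd ℝ (Fin n → ℝ) (Fin m → ℝ))).hasStrictFDerivAt (x := q0)
      simp only [coe_eval₂Hom, eval₂_X]; exact this
    have h3 := h1.mul h2
    refine ⟨_, h3.congr_of_eventuallyEq (Filter.Eventually.of_forall fun q => (map_mul (evVW q.1 q.2) p (X i)).symm), ?_⟩
    · intro w
      simp only [add_apply, smul_apply, h1', smul_eq_mul,
        Derivation.leibniz, map_add, map_mul, add_mul, Finset.sum_add_distrib, Finset.mul_sum]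
      congr 1
      · rw [Finset.sum_eq_single i]
        · simp
        · intro b _ hb; simp [pderiv_X, Pi.single_eq_of_ne hb.symm]
        · simp
      · refine Finset.sum_congr rfl fun j _ => by ring

lemma IFT {n m : ℕ} (Nn : Fin m → MvPolynomial (Fin m) (MvPolynomial (Fin n) ℝ))
    (h0 : ∀ i, evVW 0 0 (Nn i) = 0)
    (hdet : evVW 0 0 (Matrix.det (Matrix.of fun i j => pderiv j (Nn i))) ≠ 0) :
    ∃ ψ : (Fin n → ℝ) → (Fin m → ℝ), Filter.Tendsto ψ (nhds 0) (nhds 0) ∧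
      (∀ᶠ v in nhds 0, ∀ i, evVW v (ψ v) (Nn i) = 0) ∧
      ∀ᶠ q : (Fin n → ℝ) × (Fin m → ℝ) in nhds (0, 0), (∀ i, evVW q.1 q.2 (Nn i) = 0) → q.2 = ψ q.1 := by
  choose f' hf hf' using fun i => evVW_strict (0, 0) (Nn i)
  have hs : HasStrictFDerivAt (fun (q : (Fin n → ℝ) × (Fin m → ℝ)) i => evVW q.1 q.2 (Nn i))
    (ContinuousLinearMap.pi f') (0, 0) := hasStrictFDerivAt_pi.2 hf
  have hinv : (ContinuousLinearMap.pi f' ∘L .inr ℝ (Fin n → ℝ) (Fin m → ℝ)).IsInvertible := by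
    have hinj : Function.Injective (ContinuousLinearMap.pi f' ∘L .inr ℝ (Fin n → ℝ) (Fin m → ℝ)) := by
      rw [injective_iff_map_eq_zero]
      intro w hw
      have := Matrix.eq_zero_of_mulVec_eq_zero (M := (evVW (0 : Fin n → ℝ) (0 : Fin m → ℝ)).mapMatrix (Matrix.of fun i j => pderiv j (Nn i))) (v := w)
        (by rwa [← RingHom.map_det])
      apply this
      ext i
      have h3 := congrFun hw i
      simp only [ContinuousLinearMap.comp_apply, ContinuousLinearMap.inr_apply, ContinuousLinearMap.pi_apply, hf'] at h3
      simpa [Matrix.mulVec, dotProduct] using h3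
    refine ⟨(LinearEquiv.ofInjectiveEndo (ContinuousLinearMap.pi f' ∘L .inr ℝ (Fin n → ℝ) (Fin m → ℝ)).toLinearMap hinj).toContinuousLinearEquiv, ?_⟩
    ext w
    rfl
  have hz : (fun i => evVW (0 : Fin n → ℝ) (0 : Fin m → ℝ) (Nn i)) = 0 := funext h0
  refine ⟨hs.implicitFunctionOfProdDomain hinv, hs.tendsto_implicitFunctionOfProdDomain hinv, ?_, ?_⟩
  · filter_upwards [hs.eventually_apply_implicitFunctionOfProdDomain hinv] with v hv i
    have := congrFun hv i
    simp only [h0] at this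
    exact this
  · filter_upwards [hs.eventually_apply_eq_iff_implicitFunctionOfProdDomain hinv] with q hq h
    exact (hq.1 ((funext h).trans hz.symm)).symm

end Part11

section Part12
open MvPolynomial

lemma sph_compact (c : ℕ) : IsCompact {x : Fin (c+1) → ℝ | eval x (sphP c) = 0} := by
  refine Metric.isCompact_of_isClosed_isBounded (isClosed_eq (cont_eval _) continuous_const) ?_
  refine (Metric.isBounded_closedBall (x := (0 : Fin (c+1) → ℝ)) (r := 2)).subset ?_
  intro x hx
  have hx' : eval x (sphP c) = 0 := hx
  rw [sph_eval] at hx'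
  rw [mem_closedBall_zero_iff, pi_norm_le_iff_of_nonneg (by norm_num)]
  have hs : 0 ≤ ∑ j : Fin c, x (Fin.castSucc j) ^ 2 := Finset.sum_nonneg fun j _ => sq_nonneg _
  intro i
  rw [Real.norm_eq_abs]
  refine Fin.lastCases ?_ (fun j => ?_) i
  · rw [abs_le]; constructor <;> nlinarith
  · have : x (Fin.castSucc j) ^ 2 ≤ ∑ j : Fin c, x (Fin.castSucc j) ^ 2 :=
      Finset.single_le_sum (f := fun j => x (Fin.castSucc j) ^ 2) (fun j _ => sq_nonneg _) (Finset.mem_univ j)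
    apply abs_le_of_sq_le_sq _ (by norm_num)
    nlinarith [sq_nonneg (x (Fin.last c) - 1)]

lemma fP_cont {n c : ℕ} (f : Fin n → MvPolynomial (Fin c) ℝ) :
    Continuous fun x : Fin c → ℝ => (fun i => eval x (f i)) := continuous_pi fun i => cont_eval _

lemma evVW_cont' {n m : ℕ} (p : MvPolynomial (Fin m) (MvPolynomial (Fin n) ℝ)) :
    Continuous fun q : (Fin n → ℝ) × (Fin m → ℝ) => evVW q.1 q.2 p := by
  refine continuous_iff_continuousAt.2 fun q => ?_
  obtain ⟨_, h, _⟩ := evVW_strict q p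
  exact h.hasFDerivAt.continuousAt

noncomputable def NnB {n c : ℕ} (f : Fin n → MvPolynomial (Fin (c+1)) ℝ) (g : Fin c → MvPolynomial (Fin n) ℝ) :
    Fin (c+1) → MvPolynomial (Fin (c+1)) (MvPolynomial (Fin n) ℝ) :=
  Fin.lastCases (map C (sphP c)) (fun j => subP f (g j))

lemma det_NnB {n c : ℕ} (g : Fin c → MvPolynomial (Fin n) ℝ) (z0 : Fin n → ℝ) (C : Fin c → Fin n → ℝ)
    (hC : ∀ i j, dP (g i) z0 (C j) = if i = j then 1 else 0) (η : ℝ) (hη : 0 < η)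
    (H : Fin n → MvPolynomial (Fin (c+1)) ℝ) :
    evVW 0 0 (Matrix.det (Matrix.of fun i j => pderiv j (NnB (fP z0 C η H) g i))) ≠ 0 := by
  have hf0 : (fun i => eval (0 : Fin (c+1) → ℝ) (fP z0 C η H i)) = z0 := by
    rw [fP_eval]; simp [Cmap_apply]
  rw [RingHom.map_det]
  have : (evVW (0 : Fin n → ℝ) (0 : Fin (c+1) → ℝ)).mapMatrix (Matrix.of fun i j => pderiv j (NnB (fP z0 C η H) g i))
      = Matrix.diagonal (Fin.lastCases (-2) (fun _ => η)) := by
    obtain ⟨hs1, hs2⟩ := sph_strict (c := c)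
    obtain ⟨hf1, hf2⟩ := fP_strict z0 C η H
    ext i j
    rw [RingHom.mapMatrix_apply, Matrix.map_apply, Matrix.of_apply]
    refine Fin.lastCases ?_ (fun i => ?_) i
    · simp only [NnB, Fin.lastCases_last, pderiv_map]
      rw [evVW_map]
      refine Fin.lastCases ?_ (fun j => ?_) j
      · rw [hs2]; simp
      · rw [hs1, Matrix.diagonal_apply_ne _ (Fin.castSucc_lt_last j).ne']
    · simp only [NnB, Fin.lastCases_castSucc]
      rw [evVW_pderiv_sub, hf0, sub_zero]
      refine Fin.lastCases ?_ (fun j => ?_) j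
      · simp only [hf2, mul_zero, Finset.sum_const_zero]
        rw [Matrix.diagonal_apply_ne _ (Fin.castSucc_lt_last i).ne]
      · simp only [hf1]
        have h1 := hC i j
        rw [dP_apply] at h1
        have h2 : ∑ k, eval z0 (pderiv k (g i)) * (η * C j k) = η * (if i = j then 1 else 0) := by
          rw [← h1, Finset.mul_sum]
          exact Finset.sum_congr rfl fun k _ => by ring
        rw [h2]
        by_cases hij : i = j
        · subst hij; simp
        · rw [Matrix.diagonal_apply_ne _ (by simpa using hij)]; simp [hij]
  rw [this, Matrix.det_diagonal, Finset.prod_ne_zero_iff]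
  intro i _
  refine Fin.lastCases ?_ (fun j => ?_) i
  · simp
  · simpa using hη.ne'

set_option maxHeartbeats 1000000 in
lemma LB {n c : ℕ} (B : MvPolynomial (Fin n) ℝ) (hB : B ≠ 0)
    (g : Fin c → MvPolynomial (Fin n) ℝ) (z0 : Fin n → ℝ) (C : Fin c → Fin n → ℝ)
    (hz0 : eval z0 B = 0) (hg : ∀ i z, eval z B = 0 → eval z (g i) = 0)
    (hC : ∀ i j, dP (g i) z0 (C j) = if i = j then 1 else 0)
    (hnear : ∀ᶠ y in nhds z0, (∀ i, eval y (g i) = 0) → eval y B = 0)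
    (η : ℝ) (H : Fin n → MvPolynomial (Fin (c+1)) ℝ) (hη : 0 < η)
    (hS : ∀ x, eval x (sphP c) = 0 → x ≠ 0 → eval (fun i => eval x (fP z0 C η H i)) B ≠ 0) : False := by
  classical
  set f := fP z0 C η H with hfdef
  have hf0 : (fun i => eval (0 : Fin (c+1) → ℝ) (f i)) = z0 := by
    rw [hfdef, fP_eval]; simp [Cmap_apply]
  let Nn := NnB f g
  have hNl : ∀ v x, evVW v x (Nn (Fin.last c)) = eval x (sphP c) := fun v x => by
    simp only [Nn, NnB, Fin.lastCases_last]; exact evVW_map _ _ _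
  have hNc : ∀ v x j, evVW v x (Nn (Fin.castSucc j)) = eval ((fun i => eval x (f i)) - v) (g j) := fun v x j => by
    simp only [Nn, NnB, Fin.lastCases_castSucc]; exact evVW_sub _ _ _ _
  have hΔ0' : evVW 0 0 (Matrix.det (Matrix.of fun i j => pderiv j (Nn i))) ≠ 0 := det_NnB g z0 C hC η hη H
  clear_value Nn
  obtain ⟨Δ, hΔdef⟩ : ∃ Δ, Δ = Matrix.det (Matrix.of fun i j => pderiv j (Nn i)) := ⟨_, rfl⟩
  have hΔ0 : evVW 0 0 Δ ≠ 0 := by rw [hΔdef]; exact hΔ0'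
  let S : Set (MvPolynomial (Fin (c+1)) (MvPolynomial (Fin n) ℝ)) := insert (subP f B) (Set.range Nn)
  obtain ⟨δ, ε, hδ, hcard⟩ := L1 S Nn (fun i => Set.mem_insert_of_mem _ ⟨i, rfl⟩) Δ hΔdef.symm.dvd
  have hsol : ∀ v x, (∀ h ∈ S, evVW v x h = 0) ↔ (eval x (sphP c) = 0 ∧ eval ((fun i => eval x (f i)) - v) B = 0) := by
    intro v x
    constructor
    · intro h
      exact ⟨by rw [← hNl v]; exact h _ (Set.mem_insert_of_mem _ ⟨_, rfl⟩), by rw [← evVW_sub]; exact h _ (Set.mem_insert _ _)⟩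
    · rintro ⟨h1, h2⟩ h (rfl | ⟨i, rfl⟩)
      · rw [evVW_sub]; exact h2
      · refine Fin.lastCases ?_ (fun j => ?_) i
        · rw [hNl]; exact h1
        · rw [hNc]; exact hg _ _ h2
  -- far
  obtain ⟨R, hR⟩ := ((sph_compact c).image (fP_cont f)).isBounded.exists_norm_le
  obtain ⟨v', hv'⟩ := L3 B hB (|R| + 1) (by positivity)
  have hfar : ∃ v, evVW v (0 : Fin 0 → ℝ) (MvPolynomial.C δ) ≠ 0 ∧ Nat.card {w : Fin (c+1) → ℝ // evVW v w Δ ≠ 0 ∧ ∀ h ∈ S, evVW v w h = 0} = 0 := by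
    obtain ⟨v, hv1, hv2⟩ := dense_ne δ hδ (-v') (fun v => dist v (-v') < 1) (Metric.ball_mem_nhds _ one_pos)
    refine ⟨v, by simpa using hv2, ?_⟩
    have : IsEmpty {w : Fin (c+1) → ℝ // evVW v w Δ ≠ 0 ∧ ∀ h ∈ S, evVW v w h = 0} := by
      refine ⟨?_⟩
      rintro ⟨w, -, hw⟩
      obtain ⟨h1, h2⟩ := (hsol v w).1 hw
      refine hv' _ ?_ h2
      have h3 := hR _ ⟨w, h1, rfl⟩
      have h4 : ((fun i => eval w (f i)) - v) - v' = (fun i => eval w (f i)) - (v - (-v')) := by abel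
      rw [h4]
      refine (norm_sub_le _ _).trans ?_
      rw [dist_eq_norm] at hv1
      have := le_abs_self R
      linarith
    exact Nat.card_of_isEmpty
  have hclose : ∀ᶠ v in nhds (0 : Fin n → ℝ), Nat.card {w : Fin (c+1) → ℝ // evVW v w Δ ≠ 0 ∧ ∀ h ∈ S, evVW v w h = 0} = 1 := by
    have hN0 : ∀ i, evVW (0 : Fin n → ℝ) (0 : Fin (c+1) → ℝ) (Nn i) = 0 := by
      intro i
      refine Fin.lastCases ?_ (fun j => ?_) i
      · rw [hNl, sph_eval]; simp
      · rw [hNc, hf0, sub_zero]; exact hg _ _ hz0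
    obtain ⟨ψ, hψ, hψ0, hψu⟩ := IFT Nn hN0 hΔ0'
    have hΔn : ∀ᶠ q : (Fin n → ℝ) × (Fin (c+1) → ℝ) in nhds (0, 0), evVW q.1 q.2 Δ ≠ 0 := by
      have hc : Continuous fun q : (Fin n → ℝ) × (Fin (c+1) → ℝ) => evVW q.1 q.2 Δ :=
        evVW_cont' Δ
      exact hc.continuousAt.eventually_ne hΔ0
    obtain ⟨ρ, hρ, hball⟩ := Metric.eventually_nhds_iff_ball.1 (hψu.and hΔn)
    have hTc : IsCompact ({x : Fin (c+1) → ℝ | eval x (sphP c) = 0} ∩ {x | ρ ≤ ‖x‖}) :=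
      (sph_compact c).inter_right (isClosed_le continuous_const continuous_norm)
    obtain ⟨r, hr, hthick⟩ := (hTc.image (fP_cont f)).exists_thickening_subset_open
      (t := {y | eval y B ≠ 0}) (isOpen_ne_fun (cont_eval _) continuous_const) (by
        rintro _ ⟨x, ⟨hx1, hx2⟩, rfl⟩
        refine hS x hx1 ?_
        rintro rfl
        have : ρ ≤ ‖(0 : Fin (c+1) → ℝ)‖ := hx2
        rw [norm_zero] at this; linarith)
    have hpair : Filter.Tendsto (fun v => (v, ψ v)) (nhds 0) (nhds ((0 : Fin n → ℝ), (0 : Fin (c+1) → ℝ))) :=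
      Filter.tendsto_id.prodMk_nhds hψ
    have hfv : Filter.Tendsto (fun v => (fun i => eval (ψ v) (f i)) - v) (nhds 0) (nhds z0) := by
      have h1 : Filter.Tendsto (fun v => (fun i => eval (ψ v) (f i))) (nhds 0) (nhds z0) := by
        have := ((fP_cont f).tendsto 0).comp hψ
        rw [hf0] at this; exact this
      simpa using h1.sub (Filter.tendsto_id (x := nhds (0 : Fin n → ℝ)))
    filter_upwards [hψ0, hpair.eventually hΔn, hfv.eventually hnear, Metric.ball_mem_nhds (0 : Fin n → ℝ) hρ, Metric.ball_mem_nhds (0 : Fin n → ℝ) hr] with v h1 h2 h3 h4 h5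
    rw [Nat.card_eq_one_iff_unique]
    have key : ∀ w, (∀ h ∈ S, evVW v w h = 0) → w = ψ v := by
      intro w hw
      obtain ⟨hw1, hw2⟩ := (hsol v w).1 hw
      have hlt : ‖w‖ < ρ := by
        by_contra! hh
        refine hthick (a := (fun i => eval w (f i)) - v) ?_ hw2
        rw [Metric.mem_thickening_iff]
        refine ⟨_, ⟨w, ⟨hw1, hh⟩, rfl⟩, ?_⟩
        rw [dist_eq_norm]
        simpa using h5
      have := (hball (v, w) (by
        rw [Metric.mem_ball, Prod.dist_eq, max_lt_iff]
        exact ⟨h4, by simpa using hlt⟩)).1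
      exact this fun i => hw _ (Set.mem_insert_of_mem _ ⟨i, rfl⟩)
    refine ⟨⟨fun a b => Subtype.ext ((key _ a.2.2).trans (key _ b.2.2).symm)⟩, ⟨⟨ψ v, h2, ?_⟩⟩⟩
    rw [hsol]
    refine ⟨by rw [← hNl v]; exact h1 _, h3 fun j => by rw [← hNc]; exact h1 _⟩
  obtain ⟨v1, e1, e2⟩ := hfar
  obtain ⟨v2, e3, e4⟩ := dense_ne δ hδ 0 _ hclose
  have k1 := hcard v1 (by simpa using e1)
  have k2 := hcard v2 e4
  rw [e2] at k1
  rw [e3] at k2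
  omega

theorem MT {n : ℕ} (B : MvPolynomial (Fin n) ℝ) (F G : (Fin n → ℝ) → (Fin n → ℝ)) (hF : Continuous F)
    (hFU : ∀ x, eval (F x) B ≠ 0) (hG : ContinuousOn G {y | eval y B ≠ 0})
    (hFG : ∀ y, eval y B ≠ 0 → F (G y) = y) (y) : eval y B ≠ 0 := by
  intro hy
  have hB : B ≠ 0 := by rintro rfl; exact hFU 0 (map_zero _)
  obtain ⟨c, g, z0, C, hz0, hg, hC, hnear⟩ := L4 B ⟨y, hy⟩
  obtain ⟨η, H, hη, hS⟩ := LA B F G hF hFU hG hFG g z0 C hz0 hg hC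
  exact LB B hB g z0 C hz0 hg hC hnear η H hη hS

end Part12

section Part13

open MvPolynomial

def Ev {n : ℕ} (x : Fin n → ℝ) (r : RatFuncField n) (t : ℝ) : Prop :=
  ∃ p q : MvPolynomial (Fin n) ℝ, eval x q ≠ 0 ∧
    r * algebraMap (MvPolynomial (Fin n) ℝ) (RatFuncField n) q = algebraMap (MvPolynomial (Fin n) ℝ) (RatFuncField n) p ∧ t * eval x q = eval x p

lemma Ev.unique {n : ℕ} {x : Fin n → ℝ} {r : RatFuncField n} {t t' : ℝ} (h : Ev x r t) (h' : Ev x r t') : t = t' := by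
  obtain ⟨p, q, hq, hr, ht⟩ := h
  obtain ⟨p', q', hq', hr', ht'⟩ := h'
  have h1 : algebraMap (MvPolynomial (Fin n) ℝ) (RatFuncField n) (p * q') = algebraMap (MvPolynomial (Fin n) ℝ) (RatFuncField n) (p' * q) := by
    rw [map_mul, map_mul, ← hr, ← hr']; ring
  have h2 : p * q' = p' * q := IsFractionRing.injective _ (RatFuncField n) h1
  have h3 := congrArg (eval x) h2
  rw [map_mul, map_mul, ← ht, ← ht'] at h3
  have h4 : (t - t') * (eval x q * eval x q') = 0 := by linear_combination h3
  rcases mul_eq_zero.1 h4 with h | h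
  · linarith
  · exact absurd h (mul_ne_zero hq hq')

lemma Ev.alg {n : ℕ} (x : Fin n → ℝ) (p : MvPolynomial (Fin n) ℝ) :
    Ev x (algebraMap (MvPolynomial (Fin n) ℝ) (RatFuncField n) p) (eval x p) := ⟨p, 1, by simp, by simp, by simp⟩

lemma Ev.add {n : ℕ} {x : Fin n → ℝ} {r r' : RatFuncField n} {t t' : ℝ} (h : Ev x r t) (h' : Ev x r' t') :
    Ev x (r + r') (t + t') := by
  obtain ⟨p, q, hq, hr, ht⟩ := h
  obtain ⟨p', q', hq', hr', ht'⟩ := h'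
  refine ⟨p * q' + p' * q, q * q', by rw [map_mul]; exact mul_ne_zero hq hq', ?_, ?_⟩
  · simp only [map_add, map_mul, ← hr, ← hr']; ring
  · simp only [map_add, map_mul, ← ht, ← ht']; ring

lemma Ev.mul {n : ℕ} {x : Fin n → ℝ} {r r' : RatFuncField n} {t t' : ℝ} (h : Ev x r t) (h' : Ev x r' t') :
    Ev x (r * r') (t * t') := by
  obtain ⟨p, q, hq, hr, ht⟩ := h
  obtain ⟨p', q', hq', hr', ht'⟩ := h'
  refine ⟨p * p', q * q', by rw [map_mul]; exact mul_ne_zero hq hq', ?_, ?_⟩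
  · simp only [map_mul, ← hr, ← hr']; ring
  · simp only [map_mul, ← ht, ← ht']; ring

lemma Ev.aeval {n : ℕ} {x : Fin n → ℝ} {r : Fin n → RatFuncField n} {t : Fin n → ℝ} (h : ∀ i, Ev x (r i) (t i))
    (P : MvPolynomial (Fin n) ℝ) : Ev x (MvPolynomial.aeval r P) (eval t P) := by
  induction P using MvPolynomial.induction_on with
  | C a =>
    have := Ev.alg x (C a)
    rw [eval_C] at this
    rw [eval_C, aeval_C]
    rwa [← MvPolynomial.algebraMap_eq, ← IsScalarTower.algebraMap_apply] at this
  | add p q hp hq => rw [map_add, map_add]; exact hp.add hq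
  | mul_X p i hp => rw [map_mul, map_mul, aeval_X, eval_X]; exact hp.mul (h i)

lemma Ev.div {n : ℕ} {x : Fin n → ℝ} {p q : MvPolynomial (Fin n) ℝ} (hq : eval x q ≠ 0) :
    Ev x (algebraMap (MvPolynomial (Fin n) ℝ) (RatFuncField n) p / algebraMap (MvPolynomial (Fin n) ℝ) (RatFuncField n) q) (eval x p / eval x q) := by
  refine ⟨p, q, hq, div_mul_cancel₀ _ ?_, div_mul_cancel₀ _ hq⟩
  intro h
  have : q = 0 := (IsFractionRing.injective (MvPolynomial (Fin n) ℝ) (RatFuncField n)) (h.trans (map_zero _).symm)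
  exact hq (by rw [this, map_zero])

lemma rat_zero {n : ℕ} (r : RatFuncField n) (t : (Fin n → ℝ) → ℝ) (D : MvPolynomial (Fin n) ℝ) (hD : D ≠ 0)
    (a : Fin n → ℝ) (U : Set (Fin n → ℝ)) (hU : U ∈ nhds a)
    (h : ∀ x ∈ U, eval x D ≠ 0 → Ev x r 0) : r = 0 := by
  obtain ⟨P, Q, hQ, rfl⟩ := IsFractionRing.div_surjective (A := MvPolynomial (Fin n) ℝ) r
  have hQ0 : Q ≠ 0 := nonZeroDivisors.ne_zero hQ
  by_contra hr
  have hP : P ≠ 0 := by rintro rfl; simp at hr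
  obtain ⟨x, hx, hne⟩ := dense_ne (P * Q * D) (mul_ne_zero (mul_ne_zero hP hQ0) hD) a (fun x => x ∈ U) hU
  rw [map_mul, map_mul] at hne
  have h1 := left_ne_zero_of_mul hne
  have h2 := (Ev.div (p := P) (right_ne_zero_of_mul h1)).unique (h x hx (right_ne_zero_of_mul hne))
  exact div_ne_zero (left_ne_zero_of_mul h1) (right_ne_zero_of_mul h1) h2

lemma map_analytic {n : ℕ} {F : (Fin n → ℝ) → (Fin n → ℝ)} {f} (hF : IsEverywhereDefRatMap n F f) :
    AnalyticOnNhd ℝ F Set.univ := by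
  rw [analyticOnNhd_pi_iff]
  intro i
  obtain ⟨p, q, hq, -, h⟩ := hF i
  have := (AnalyticOnNhd.eval_mvPolynomial p).div (AnalyticOnNhd.eval_mvPolynomial q) (fun x _ => hq x)
  exact (funext h : (fun x => F x i) = fun x => eval x p / eval x q) ▸ this

lemma step14 {n : ℕ} (F : (Fin n → ℝ) → (Fin n → ℝ)) (f : Fin n → RatFuncField n)
    (hF : IsEverywhereDefRatMap n F f) (hinj : Function.Injective F)
    (σ : RatFuncField n ≃ₐ[IntermediateField.adjoin ℝ (Set.range f)] RatFuncField n) : σ = AlgEquiv.refl := by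
  classical
  choose p q hq hf hFx using hF
  have hsurj := fun k => IsFractionRing.div_surjective (A := MvPolynomial (Fin n) ℝ) (σ (algebraMap (MvPolynomial (Fin n) ℝ) (RatFuncField n) (X k)))
  choose P Q hQ hs using hsurj
  let s : Fin n → RatFuncField n := fun k => σ (algebraMap (MvPolynomial (Fin n) ℝ) (RatFuncField n) (X k))
  have hQ0 : ∀ k, Q k ≠ 0 := fun k => nonZeroDivisors.ne_zero (hQ k)
  let σ' : RatFuncField n →ₐ[ℝ] RatFuncField n := (σ.restrictScalars ℝ).toAlgHom
  have hσa : ∀ p : MvPolynomial (Fin n) ℝ, σ (algebraMap (MvPolynomial (Fin n) ℝ) (RatFuncField n) p) = aeval s p := by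
    intro p
    have : (σ'.comp (IsScalarTower.toAlgHom ℝ (MvPolynomial (Fin n) ℝ) (RatFuncField n))) = aeval s := by
      apply MvPolynomial.algHom_ext
      intro i
      rw [aeval_X]; rfl
    exact DFunLike.congr_fun this p
  have hσf : ∀ i, σ (f i) = f i := fun i =>
    σ.commutes ⟨f i, IntermediateField.subset_adjoin _ _ ⟨i, rfl⟩⟩
  have hq0 : ∀ i, algebraMap (MvPolynomial (Fin n) ℝ) (RatFuncField n) (q i) ≠ 0 := by
    intro i h
    have : q i = 0 := (IsFractionRing.injective (MvPolynomial (Fin n) ℝ) (RatFuncField n)) (h.trans (map_zero _).symm)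
    exact hq i 0 (by rw [this, map_zero])
  have hrel : ∀ i, f i * aeval s (q i) = aeval s (p i) := by
    intro i
    rw [← hσa, ← hσa, ← hσf, ← map_mul, hf, div_mul_cancel₀ _ (hq0 i)]
  have hX : ∀ k, s k = algebraMap (MvPolynomial (Fin n) ℝ) (RatFuncField n) (X k) := by
    intro k
    rw [← sub_eq_zero]
    refine rat_zero _ (fun _ => 0) (∏ k, Q k) (Finset.prod_ne_zero_iff.2 fun k _ => hQ0 k) 0 Set.univ Filter.univ_mem ?_
    intro x _ hx
    rw [map_prod, Finset.prod_ne_zero_iff] at hx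
    have hx' : ∀ k, eval x (Q k) ≠ 0 := fun k => hx k (Finset.mem_univ k)
    have hev : ∀ k, Ev x (s k) (eval x (P k) / eval x (Q k)) := fun k => by
      simp only [s]; rw [← hs k]; exact Ev.div (hx' k)
    have hfe : ∀ i, Ev x (f i) (F x i) := fun i => by rw [hf, hFx]; exact Ev.div (hq i x)
    have hSx : (fun k => eval x (P k) / eval x (Q k)) = x := by
      apply hinj
      ext i
      have h1 := (hfe i).mul (Ev.aeval hev (q i))
      rw [hrel] at h1
      have h2 := h1.unique (Ev.aeval hev (p i))
      rw [hFx i (fun k => _), div_eq_iff (hq i _)]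
      exact h2.symm
    have h3 := hev k
    have h4 : eval x (P k) / eval x (Q k) = x k := congrFun hSx k
    rw [h4] at h3
    have h5 := h3.add (Ev.alg x (-(X k)))
    simpa [sub_eq_add_neg] using h5
  have hid : ∀ p : MvPolynomial (Fin n) ℝ, σ (algebraMap (MvPolynomial (Fin n) ℝ) (RatFuncField n) p) = algebraMap (MvPolynomial (Fin n) ℝ) (RatFuncField n) p := by
    intro p
    rw [hσa]
    have : aeval s = IsScalarTower.toAlgHom ℝ (MvPolynomial (Fin n) ℝ) (RatFuncField n) := by
      apply MvPolynomial.algHom_ext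
      intro i
      rw [aeval_X, hX]; rfl
    rw [this]; rfl
  ext r
  obtain ⟨a, b, -, rfl⟩ := IsFractionRing.div_surjective (A := MvPolynomial (Fin n) ℝ) r
  rw [map_div₀, hid, hid]; rfl

lemma step43 {K E : Type*} [Field K] [Field E] [Algebra K E] (L : IntermediateField K E) [IsGalois L E]
    [Subsingleton (E ≃ₐ[L] E)] : L = ⊤ := by
  rw [eq_top_iff]
  intro x _
  obtain ⟨y, hy⟩ := (InfiniteGalois.mem_range_algebraMap_iff_fixed (k := L) x).2 fun σ => by
    rw [Subsingleton.elim σ AlgEquiv.refl]; rfl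
  rw [← hy]; exact y.2

lemma step32 {n : ℕ} (F : (Fin n → ℝ) → (Fin n → ℝ)) (f : Fin n → RatFuncField n)
    (hF : IsEverywhereDefRatMap n F f) (hjac : ∀ x : Fin n → ℝ, (fderiv ℝ F x).det ≠ 0)
    (htop : IntermediateField.adjoin ℝ (Set.range f) = ⊤) :
    ∃ (G : (Fin n → ℝ) → (Fin n → ℝ)) (g : Fin n → RatFuncField n),
          IsEverywhereDefRatMap n G g ∧ (∀ x, G (F x) = x) ∧ (∀ y, F (G y) = y) := by
  classical
  have han := map_analytic hF
  choose p q hq hf hFx using hF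
  have hfe : ∀ x i, Ev x (f i) (F x i) := fun x i => by rw [hf, hFx]; exact Ev.div (hq i x)
  have hqne : ∀ i, q i ≠ 0 := fun i h => hq i 0 (by rw [h, map_zero])
  have hab : ∀ k, ∃ a b : MvPolynomial (Fin n) ℝ, IsRelPrime b a ∧ 
      aeval f b * algebraMap (MvPolynomial (Fin n) ℝ) (RatFuncField n) (X k) = aeval f a := by
    intro k
    have hmem : algebraMap (MvPolynomial (Fin n) ℝ) (RatFuncField n) (X k) ∈ IntermediateField.adjoin ℝ (Set.range f) := by
      rw [htop]; trivial
    rw [IntermediateField.mem_adjoin_range_iff] at hmem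
    obtain ⟨r, s, hrs⟩ := hmem
    have hs : aeval f s ≠ 0 := by
      intro h
      rw [h, div_zero] at hrs
      exact MvPolynomial.X_ne_zero (R := ℝ) k ((IsFractionRing.injective (MvPolynomial (Fin n) ℝ) (RatFuncField n)) (hrs.trans (map_zero _).symm))
    have hs0 : s ≠ 0 := by rintro rfl; simp at hs
    obtain ⟨b, a, c, hrel, hb, ha⟩ := UniqueFactorizationMonoid.exists_reduced_factors s hs0 r
    refine ⟨a, b, hrel, ?_⟩
    rw [eq_div_iff hs, ← hb, ← ha, map_mul, map_mul] at hrs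
    rw [← hb, map_mul] at hs
    apply mul_left_cancel₀ (left_ne_zero_of_mul hs)
    linear_combination hrs
  choose a b hrel hid using hab
  have hff : f = fun i => algebraMap (MvPolynomial (Fin n) ℝ) (RatFuncField n) (p i) / algebraMap (MvPolynomial (Fin n) ℝ) (RatFuncField n) (q i) := funext hf
  have hdet : ∀ x, (Matrix.of fun i j => F x i * eval x (pderiv j (q i)) - eval x (pderiv j (p i))).det ≠ 0 := by
    intro x
    have hd : HasFDerivAt F (fderiv ℝ F x) x := (han x (Set.mem_univ x)).differentiableAt.hasFDerivAt
    have key : ∀ i j, F x i * eval x (pderiv j (q i)) - eval x (pderiv j (p i)) = - eval x (q i) * (fderiv ℝ F x (Pi.single j 1)) i := by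
      intro i j
      have h1 := (hasFDerivAt_pi'.1 hd i).mul (hasStrict_eval (q i) x).hasFDerivAt
      have h2 : (fun y => F y i) * (fun y => eval y (q i)) = fun y => eval y (p i) := by
        funext y
        simp only [Pi.mul_apply, hFx]
        exact div_mul_cancel₀ _ (hq i y)
      have h3 := h1.unique (h2 ▸ (hasStrict_eval (p i) x).hasFDerivAt)
      have h4 := DFunLike.congr_fun h3 (Pi.single j 1)
      have hpi : ∀ h : MvPolynomial (Fin n) ℝ, dP h x (Pi.single j 1) = eval x (pderiv j h) := by
        intro h
        rw [dP_apply]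
        simp [Pi.single_apply]
      simp only [add_apply, smul_apply, smul_eq_mul, hpi] at h4
      have h5 : (ContinuousLinearMap.proj (R := ℝ) (φ := fun _ : Fin n => ℝ) i ∘L fderiv ℝ F x) (Pi.single j 1) = (fderiv ℝ F x (Pi.single j 1)) i := rfl
      rw [h5] at h4
      linear_combination h4
    have hM : (Matrix.of fun i j => F x i * eval x (pderiv j (q i)) - eval x (pderiv j (p i))) =
        Matrix.diagonal (fun i => - eval x (q i)) * LinearMap.toMatrix' (fderiv ℝ F x).toLinearMap := by
      ext i j
      rw [Matrix.diagonal_mul, LinearMap.toMatrix'_apply, Matrix.of_apply, key]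
      congr 3
    rw [hM, Matrix.det_mul, Matrix.det_diagonal, LinearMap.det_toMatrix']
    exact mul_ne_zero (Finset.prod_ne_zero_iff.2 fun i _ => neg_ne_zero.2 (hq i x)) (hjac x)
  have hbF : ∀ k x, eval (F x) (b k) ≠ 0 := by
    intro k x
    refine L5 p q (a k) (b k) k (fun t ht => (hrel k).dvd_of_dvd_mul_left ht) hqne ?_ x (F x) (fun i => hq i x) ?_ (hdet x)
    · have := hid k
      rw [hff] at this
      exact this
    · intro i; rw [hFx, div_mul_cancel₀ _ (hq i x)]
  let G : (Fin n → ℝ) → (Fin n → ℝ) := fun y k => eval y (a k) / eval y (b k)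
  have hGF : ∀ x, G (F x) = x := by
    intro x
    ext k
    have h1 := (Ev.aeval (hfe x) (b k)).mul (Ev.alg x (X k))
    rw [hid] at h1
    have h2 := h1.unique (Ev.aeval (hfe x) (a k))
    rw [eval_X] at h2
    simp only [G]
    rw [div_eq_iff (hbF k x), ← h2, mul_comm]
  let B := ∏ k, b k
  have hB : ∀ y, eval y B ≠ 0 ↔ ∀ k, eval y (b k) ≠ 0 := fun y => by
    simp only [B, map_prod, Finset.prod_ne_zero_iff, Finset.mem_univ, true_imp_iff]
  let γ : Fin n → RatFuncField n := fun k => algebraMap (MvPolynomial (Fin n) ℝ) (RatFuncField n) (a k) / algebraMap (MvPolynomial (Fin n) ℝ) (RatFuncField n) (b k)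
  have hγ : ∀ y, eval y B ≠ 0 → ∀ k, Ev y (γ k) (G y k) := fun y hy k => Ev.div ((hB y).1 hy k)
  have hopen : Set.range F ∈ nhds (F 0) := by
    have hs : HasStrictFDerivAt F (fderiv ℝ F 0) 0 := (han 0 (Set.mem_univ 0)).hasStrictFDerivAt
    have hsurj : (fderiv ℝ F 0).range = ⊤ := by
      exact (LinearMap.range_eq_top).2 (LinearMap.equivOfDetNeZero _ (hjac 0)).surjective
    rw [← hs.map_nhds_eq_of_surj hsurj]
    exact Filter.mem_map.2 (Filter.Eventually.of_forall fun x => ⟨x, rfl⟩)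
  have hEvr : ∀ y, eval y B ≠ 0 → ∀ i, Ev y (algebraMap (MvPolynomial (Fin n) ℝ) (RatFuncField n) (X i) * aeval γ (q i) + aeval γ (- p i))
      (y i * eval (G y) (q i) + eval (G y) (- p i)) := by
    intro y hy i
    have h1 := Ev.alg y (X i)
    rw [eval_X] at h1
    exact (h1.mul (Ev.aeval (hγ y hy) _)).add (Ev.aeval (hγ y hy) _)
  have hr0 : ∀ i, algebraMap (MvPolynomial (Fin n) ℝ) (RatFuncField n) (X i) * aeval γ (q i) + aeval γ (- p i) = 0 := by
    intro i
    refine rat_zero _ (fun _ => 0) 1 one_ne_zero (F 0) _ hopen ?_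
    rintro _ ⟨x, rfl⟩ _
    have h1 := hEvr (F x) ((hB _).2 fun k => hbF k x) i
    rw [hGF, map_neg (eval x), hFx, div_mul_cancel₀ _ (hq i x), add_neg_cancel] at h1
    exact h1
  have hFG : ∀ y, eval y B ≠ 0 → F (G y) = y := by
    intro y hy
    ext i
    have h1 := hEvr y hy i
    rw [hr0] at h1
    have h2 := h1.unique (by simpa using Ev.alg y (0 : MvPolynomial (Fin n) ℝ))
    rw [hFx, div_eq_iff (hq i _)]
    rw [map_neg] at h2
    linear_combination -h2
  have hall : ∀ y, eval y B ≠ 0 := by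
    refine MT B F G (continuousOn_univ.1 han.continuousOn) (fun x => (hB _).2 fun k => hbF k x) ?_ hFG
    refine continuousOn_pi.2 fun k => ?_
    exact (cont_eval _).continuousOn.div (cont_eval _).continuousOn (fun y hy => (hB y).1 hy k)
  exact ⟨G, γ, fun k => ⟨a k, b k, fun y => (hB y).1 (hall y) k, rfl, fun _ => rfl⟩, hGF, fun y => hFG y (hall y)⟩


end Part13

/-- Galois case of the RRJC: for an everywhere defined real rational map
`F : ℝⁿ → ℝⁿ` with nowhere vanishing Jacobian determinant such that the extension
`ℝ(F) ⊆ ℝ(x₁, …, xₙ)` is Galois, the following are equivalent: (1) `F` is a bijection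
with real analytic inverse; (2) `F` has an everywhere defined real rational inverse;
(3) `F` is birational; (4) the Galois group is trivial. -/
theorem galois_case_RRJC
    (n : ℕ) (F : (Fin n → ℝ) → (Fin n → ℝ))
    (f : Fin n → RatFuncField n)
    (hF : IsEverywhereDefRatMap n F f)
    (hjac : ∀ x : Fin n → ℝ, (fderiv ℝ F x).det ≠ 0)
    (hgal : IsGalois (IntermediateField.adjoin ℝ (Set.range f)) (RatFuncField n)) :
    List.TFAE
      [ Function.Bijective F ∧
          ∃ G : (Fin n → ℝ) → (Fin n → ℝ),
            (∀ x, G (F x) = x) ∧ (∀ y, F (G y) = y) ∧ AnalyticOnNhd ℝ G Set.univ,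
        ∃ (G : (Fin n → ℝ) → (Fin n → ℝ)) (g : Fin n → RatFuncField n),
          IsEverywhereDefRatMap n G g ∧ (∀ x, G (F x) = x) ∧ (∀ y, F (G y) = y),
        IntermediateField.adjoin ℝ (Set.range f) = ⊤,
        Subsingleton
          (RatFuncField n ≃ₐ[IntermediateField.adjoin ℝ (Set.range f)] RatFuncField n) ] := by
  tfae_have 1 → 4 := fun h => ⟨fun σ τ => (step14 F f hF h.1.1 σ).trans (step14 F f hF h.1.1 τ).symm⟩
  tfae_have 4 → 3 := fun h => step43 _
  tfae_have 3 → 2 := fun h => step32 F f hF hjac h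
  tfae_have 2 → 1 := by
    rintro ⟨G, g, hG, h1, h2⟩
    exact ⟨⟨Function.LeftInverse.injective h1, Function.RightInverse.surjective h2⟩, G, h1, h2, map_analytic hG⟩
  tfae_finish
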